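/- arXiv:1602.00233 — 2 statements merged into one kernel-verified Lean document; each statement's English description precedes it below -/
import Mathlib

section
/- Subadditivity of the operator-valued variance: Let X₁,…,Xₙ be independent random variables on a product probability space and let Z = f(X₁,…,Xₙ) be a d×d positive semidefinite random matrix such that Z and Z² are Bochner integrable. Then E[Z²] − (E[Z])² ⪯ Σ_{i=1}^n E[ E_i[Z²] − (E_i[Z])² ] in the Löwner order, where E_i denotes integration over the i-th coordinate only (conditional expectation given X_{-i} = (X₁,…,X_{i−1},X_{i+1},…,Xₙ)). -/
open MeasureTheory
open scoped ComplexOrder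

noncomputable section

/-- The space of `d × d` complex matrices. -/
abbrev Mat (d : ℕ) := Matrix (Fin d) (Fin d) ℂ

/-- Löwner partial order: `A ⪯ B` iff `B - A` is positive semidefinite. -/
def LoewnerLE {d : ℕ} (A B : Mat d) : Prop := (B - A).PosSemidef

/-- Entrywise Bochner expectation of a matrix-valued random variable. -/
def expMat {Ω : Type*} [MeasurableSpace Ω] (μ : Measure Ω) {d : ℕ}
    (Z : Ω → Mat d) : Mat d := Matrix.of fun i j => ∫ ω, Z ω i j ∂μ

/-- Entrywise Bochner integrability of a matrix-valued random variable. -/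
def MatIntegrable {Ω : Type*} [MeasurableSpace Ω] (μ : Measure Ω) {d : ℕ}
    (Z : Ω → Mat d) : Prop := ∀ i j, Integrable (fun ω => Z ω i j) μ


section SquareNorm

variable {α β H : Type*} [MeasurableSpace α] [MeasurableSpace β]
  [NormedAddCommGroup H]

theorem memLp_two_iff_lintegral_enorm_sq_lt_top {μ : Measure α} {X : α → H}
    (hX : AEStronglyMeasurable X μ) : MemLp X 2 μ ↔ ∫⁻ a, ‖X a‖ₑ ^ 2 ∂μ < ⊤ := by
  rw [memLp_two_iff_integrable_sq_norm hX, Integrable, hasFiniteIntegral_iff_enorm]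
  simp only [enorm_pow, enorm_norm]
  exact and_iff_right (hX.norm.pow 2)

theorem ofReal_integral_norm_sq {μ : Measure α} {X : α → H} (hX : MemLp X 2 μ) :
    ENNReal.ofReal (∫ a, ‖X a‖ ^ 2 ∂μ) = ∫⁻ a, ‖X a‖ₑ ^ 2 ∂μ := by
  rw [ofReal_integral_eq_lintegral_ofReal
    ((memLp_two_iff_integrable_sq_norm hX.aestronglyMeasurable).1 hX)
    (.of_forall fun _ => by positivity)]
  simp [ENNReal.ofReal_pow]

variable [InnerProductSpace ℝ H] [CompleteSpace H]

theorem integral_norm_sub_integral_sq {μ : Measure α} [IsProbabilityMeasure μ] {X : α → H}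
    (hX : MemLp X 2 μ) :
    ∫ a, ‖X a - ∫ b, X b ∂μ‖ ^ 2 ∂μ = ∫ a, ‖X a‖ ^ 2 ∂μ - ‖∫ a, X a ∂μ‖ ^ 2 := by
  have hi : Integrable X μ := hX.integrable (by norm_num)
  have hsq := (memLp_two_iff_integrable_sq_norm hX.aestronglyMeasurable).1 hX
  set c := ∫ b, X b ∂μ with hc
  have hin : Integrable (fun a => 2 * inner ℝ c (X a)) μ := (hi.const_inner c).const_mul 2
  have h1 : ∀ a, ‖X a - c‖ ^ 2 = ‖X a‖ ^ 2 - 2 * inner ℝ c (X a) + ‖c‖ ^ 2 := fun a => by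
    rw [norm_sub_sq_real, real_inner_comm]
  simp_rw [h1]
  have hsub : Integrable (fun a => ‖X a‖ ^ 2 - 2 * inner ℝ c (X a)) μ := hsq.sub hin
  rw [integral_add hsub (integrable_const _), integral_sub hsq hin, integral_const_mul,
    integral_inner hi, ← hc, real_inner_self_eq_norm_sq]
  simp
  ring

theorem lintegral_enorm_sub_integral_sq {μ : Measure α} [IsProbabilityMeasure μ] {X : α → H}
    (hX : Integrable X μ) :
    ∫⁻ a, ‖X a - ∫ b, X b ∂μ‖ₑ ^ 2 ∂μ + ‖∫ a, X a ∂μ‖ₑ ^ 2 = ∫⁻ a, ‖X a‖ₑ ^ 2 ∂μ := by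
  have hc : MemLp (fun _ : α => ∫ b, X b ∂μ) 2 μ := memLp_const _
  by_cases h : MemLp X 2 μ
  · have h' : MemLp (fun a => X a - ∫ b, X b ∂μ) 2 μ := h.sub hc
    rw [← ofReal_integral_norm_sq h, ← ofReal_integral_norm_sq h', ← ofReal_norm,
      ← ENNReal.ofReal_pow (norm_nonneg _), ← ENNReal.ofReal_add (by positivity) (by positivity),
      integral_norm_sub_integral_sq h, sub_add_cancel]
  · have h' : ¬ MemLp (fun a => X a - ∫ b, X b ∂μ) 2 μ := fun h' =>
      h (by simpa only [Pi.add_def, sub_add_cancel] using h'.add hc)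
    rw [memLp_two_iff_lintegral_enorm_sq_lt_top hX.aestronglyMeasurable, not_lt_top_iff] at h
    have hs : AEStronglyMeasurable (fun a => X a - ∫ b, X b ∂μ) μ :=
      hX.aestronglyMeasurable.sub hc.1
    rw [memLp_two_iff_lintegral_enorm_sq_lt_top hs, not_lt_top_iff] at h'
    rw [h, h', top_add]

theorem enorm_integral_sq_le {μ : Measure α} [IsProbabilityMeasure μ] (X : α → H) :
    ‖∫ a, X a ∂μ‖ₑ ^ 2 ≤ ∫⁻ a, ‖X a‖ₑ ^ 2 ∂μ := by
  by_cases h : Integrable X μ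
  · rw [← lintegral_enorm_sub_integral_sq h]
    exact le_add_self
  · simp [integral_undef h]

/-- Two-factor form of the subadditivity of the variance. -/
theorem lintegral_marginal_sq_add_le {μ : Measure α} {ν : Measure β} [IsProbabilityMeasure μ]
    [IsProbabilityMeasure ν] {h : α × β → H} (hh : StronglyMeasurable h) :
    ∫⁻ a, ‖∫ b, h (a, b) ∂ν‖ₑ ^ 2 ∂μ + ∫⁻ b, ‖∫ a, h (a, b) ∂μ‖ₑ ^ 2 ∂ν
      ≤ ∫⁻ p, ‖h p‖ₑ ^ 2 ∂μ.prod ν + ‖∫ p, h p ∂μ.prod ν‖ₑ ^ 2 := by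
  by_cases h2 : MemLp h 2 (μ.prod ν)
  swap
  · rw [memLp_two_iff_lintegral_enorm_sq_lt_top hh.aestronglyMeasurable, not_lt_top_iff] at h2
    simp [h2]
  have hi : Integrable h (μ.prod ν) := h2.integrable (by norm_num)
  set A : α → H := fun a => ∫ b, h (a, b) ∂ν with hA
  set B : β → H := fun b => ∫ a, h (a, b) ∂μ with hB
  have hAm : StronglyMeasurable A := hh.integral_prod_right'
  have hAi : Integrable A μ := hi.integral_prod_left
  have hBi : Integrable B ν := hi.integral_prod_right
  have hm : ∫ p, h p ∂μ.prod ν = ∫ a, A a ∂μ := integral_prod _ hi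
  have hm' : ∫ p, h p ∂μ.prod ν = ∫ b, B b ∂ν := integral_prod_symm _ hi
  have hsub : StronglyMeasurable fun p : α × β => h p - A p.1 :=
    hh.sub (hAm.comp_measurable measurable_fst)
  have e1 : ∫⁻ p, ‖h p - A p.1‖ₑ ^ 2 ∂μ.prod ν + ∫⁻ a, ‖A a‖ₑ ^ 2 ∂μ
      = ∫⁻ p, ‖h p‖ₑ ^ 2 ∂μ.prod ν := by
    rw [lintegral_prod _ (by fun_prop), lintegral_prod _ (by fun_prop),
      ← lintegral_add_right _ (by fun_prop)]
    refine lintegral_congr_ae ?_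
    filter_upwards [hi.prod_right_ae] with a ha
    exact lintegral_enorm_sub_integral_sq ha
  have e2 : ∫⁻ b, ‖B b - ∫ b, B b ∂ν‖ₑ ^ 2 ∂ν
      ≤ ∫⁻ p, ‖h p - A p.1‖ₑ ^ 2 ∂μ.prod ν := by
    rw [lintegral_prod_symm _ (by fun_prop)]
    refine lintegral_mono_ae ?_
    filter_upwards [hi.prod_left_ae] with b hb
    rw [← hm', hm, hB, ← integral_sub hb hAi]
    exact enorm_integral_sq_le _
  rw [← e1, hm', ← lintegral_enorm_sub_integral_sq hBi, add_comm (lintegral ..), add_right_comm]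
  gcongr

end SquareNorm

section Product

variable {H : Type*} [NormedAddCommGroup H]

theorem measurePreserving_update {ι : Type*} [Fintype ι] [DecidableEq ι] {Ω : ι → Type*}
    [∀ i, MeasurableSpace (Ω i)] (μ : ∀ i, Measure (Ω i)) [∀ i, IsProbabilityMeasure (μ i)]
    (i : ι) :
    MeasurePreserving (fun p : (∀ j, Ω j) × Ω i => Function.update p.1 i p.2)
      ((Measure.pi μ).prod (μ i)) (Measure.pi μ) := by
  refine ⟨measurable_update', (Measure.pi_eq fun s hs => ?_).symm⟩
  rw [Measure.map_apply measurable_update' (.univ_pi hs)]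
  have : (fun p : (∀ j, Ω j) × Ω i => Function.update p.1 i p.2) ⁻¹' Set.univ.pi s
      = Set.univ.pi (Function.update s i Set.univ) ×ˢ s i := by
    ext p
    simp only [Set.mem_preimage, Set.mem_univ_pi, Set.mem_prod]
    rw [Function.forall_update_iff (p := fun j (y : Ω j) => y ∈ s j),
      Function.forall_update_iff (p := fun j (t : Set (Ω j)) => p.1 j ∈ t)]
    simp [and_comm]
  rw [this, Measure.prod_prod, Measure.pi_pi, ← Finset.mul_prod_erase _ _ (Finset.mem_univ i),
    ← Finset.mul_prod_erase _ (fun j => μ j (s j)) (Finset.mem_univ i), mul_comm]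
  simp only [Function.update_self, measure_univ, one_mul]
  congr 1
  refine Finset.prod_congr rfl fun j hj => ?_
  rw [Function.update_of_ne (Finset.ne_of_mem_erase hj)]

theorem stronglyMeasurable_integral_update [NormedSpace ℝ H] {ι : Type*}
    [DecidableEq ι] {Ω : ι → Type*} [∀ i, MeasurableSpace (Ω i)] (μ : ∀ i, Measure (Ω i))
    [∀ i, IsProbabilityMeasure (μ i)] {h : (∀ i, Ω i) → H} (hh : StronglyMeasurable h) (i : ι) :
    StronglyMeasurable fun x => ∫ y, h (Function.update x i y) ∂μ i :=
  (hh.comp_measurable measurable_update').integral_prod_right'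

variable [InnerProductSpace ℝ H] [CompleteSpace H]

/-- **Efron–Stein inequality**, in a form without subtractions, for functions with values in a
Hilbert space. -/
theorem lintegral_sq_add_sum_marginal_sq_le {n : ℕ} {Ω : Fin n → Type*}
    [∀ i, MeasurableSpace (Ω i)] (μ : ∀ i, Measure (Ω i)) [∀ i, IsProbabilityMeasure (μ i)]
    {h : (∀ i, Ω i) → H} (hh : StronglyMeasurable h) :
    ∫⁻ x, ‖h x‖ₑ ^ 2 ∂Measure.pi μ
        + ∑ i, ∫⁻ x, ‖∫ y, h (Function.update x i y) ∂μ i‖ₑ ^ 2 ∂Measure.pi μ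
      ≤ n * ∫⁻ x, ‖h x‖ₑ ^ 2 ∂Measure.pi μ + ‖∫ x, h x ∂Measure.pi μ‖ₑ ^ 2 := by
  induction n with
  | zero => simp [Measure.pi_of_empty μ]
  | succ n ih =>
    set ν : ∀ i : Fin n, Measure (Ω i.succ) := fun i => μ i.succ with hν
    have hcons : ⇑(MeasurableEquiv.piFinSuccAbove Ω 0).symm
        = fun p : Ω 0 × (∀ i : Fin n, Ω i.succ) => (Fin.cons p.1 p.2 : ∀ i, Ω i) := by
      funext p
      exact funext fun j => j.cases rfl fun _ => rfl
    have hmp : MeasurePreserving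
        (fun p : Ω 0 × (∀ i : Fin n, Ω i.succ) => (Fin.cons p.1 p.2 : ∀ i, Ω i))
        ((μ 0).prod (Measure.pi ν)) (Measure.pi μ) :=
      hcons ▸ (measurePreserving_piFinSuccAbove μ 0).symm
    have hemb : MeasurableEmbedding
        (fun p : Ω 0 × (∀ i : Fin n, Ω i.succ) => (Fin.cons p.1 p.2 : ∀ i, Ω i)) :=
      hcons ▸ (MeasurableEquiv.piFinSuccAbove Ω 0).symm.measurableEmbedding
    set g : Ω 0 × (∀ i : Fin n, Ω i.succ) → H := fun p => h (Fin.cons p.1 p.2) with hg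
    have hgm : StronglyMeasurable g := hh.comp_measurable hmp.measurable
    have hl : ∀ F : (∀ i, Ω i) → ENNReal, Measurable F → ∫⁻ x, F x ∂Measure.pi μ
        = ∫⁻ a, ∫⁻ b, F (Fin.cons a b) ∂Measure.pi ν ∂μ 0 := fun F hF => by
      rw [← hmp.lintegral_comp hF,
        lintegral_prod (fun p => F (Fin.cons p.1 p.2)) (hF.comp hmp.measurable).aemeasurable]
    have hE : ∀ i, Measurable fun x => ‖∫ y, h (Function.update x i y) ∂μ i‖ₑ ^ 2 := fun i =>
      (stronglyMeasurable_integral_update μ hh i).enorm.pow_const 2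
    have hE' : ∀ i : Fin n, Measurable fun a =>
        ∫⁻ b, ‖∫ y, g (a, Function.update b i y) ∂ν i‖ₑ ^ 2 ∂Measure.pi ν := fun i => by
      have := ((hE i.succ).comp hmp.measurable).lintegral_prod_right' (ν := Measure.pi ν)
      simpa only [Function.comp_def, ← Fin.cons_update] using! this
    have hsec : ∫⁻ a, (∫⁻ b, ‖g (a, b)‖ₑ ^ 2 ∂Measure.pi ν
          + ∑ i, ∫⁻ b, ‖∫ y, g (a, Function.update b i y) ∂ν i‖ₑ ^ 2 ∂Measure.pi ν) ∂μ 0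
        ≤ ∫⁻ a, (n * ∫⁻ b, ‖g (a, b)‖ₑ ^ 2 ∂Measure.pi ν
          + ‖∫ b, g (a, b) ∂Measure.pi ν‖ₑ ^ 2) ∂μ 0 :=
      lintegral_mono fun a => ih ν (hgm.comp_measurable measurable_prodMk_left)
    have hgs : Measurable fun a => ∫⁻ b, ‖g (a, b)‖ₑ ^ 2 ∂Measure.pi ν :=
      (hgm.enorm.pow_const 2).lintegral_prod_right'
    rw [lintegral_add_left hgs, lintegral_add_left (hgs.const_mul _),
      lintegral_const_mul _ hgs, lintegral_finsetSum _ fun i _ => hE' i,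
      ← lintegral_prod _ (hgm.enorm.pow_const 2).aemeasurable] at hsec
    have htwo := lintegral_marginal_sq_add_le (μ := μ 0) (ν := Measure.pi ν) hgm
    have hm : ∫ x, h x ∂Measure.pi μ = ∫ p, g p ∂(μ 0).prod (Measure.pi ν) :=
      (hmp.integral_comp hemb h).symm
    have hS : ∫⁻ x, ‖h x‖ₑ ^ 2 ∂Measure.pi μ
        = ∫⁻ p, ‖g p‖ₑ ^ 2 ∂(μ 0).prod (Measure.pi ν) :=
      (hmp.lintegral_comp (hh.enorm.pow_const 2)).symm
    have h0 : ∫⁻ x, ‖∫ y, h (Function.update x 0 y) ∂μ 0‖ₑ ^ 2 ∂Measure.pi μ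
        = ∫⁻ b, ‖∫ a, g (a, b) ∂μ 0‖ₑ ^ 2 ∂Measure.pi ν := by
      rw [hl _ (hE 0)]
      simp [Fin.update_cons_zero, hg]
    have hsucc : ∀ i : Fin n,
        ∫⁻ x, ‖∫ y, h (Function.update x i.succ y) ∂μ i.succ‖ₑ ^ 2 ∂Measure.pi μ
        = ∫⁻ a, ∫⁻ b, ‖∫ y, g (a, Function.update b i y) ∂ν i‖ₑ ^ 2 ∂Measure.pi ν ∂μ 0 :=
      fun i => by
        rw [hl _ (hE i.succ)]
        simp only [← Fin.cons_update, hg, hν]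
    rw [Fin.sum_univ_succ, h0, hm, hS]
    simp_rw [hsucc]
    set S := ∫⁻ p, ‖g p‖ₑ ^ 2 ∂(μ 0).prod (Measure.pi ν)
    calc _ = (S + ∑ i, ∫⁻ a, ∫⁻ b,
            ‖∫ y, g (a, Function.update b i y) ∂ν i‖ₑ ^ 2 ∂Measure.pi ν ∂μ 0)
          + ∫⁻ b, ‖∫ a, g (a, b) ∂μ 0‖ₑ ^ 2 ∂Measure.pi ν := by ring
      _ ≤ n * S + (∫⁻ a, ‖∫ b, g (a, b) ∂Measure.pi ν‖ₑ ^ 2 ∂μ 0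
          + ∫⁻ b, ‖∫ a, g (a, b) ∂μ 0‖ₑ ^ 2 ∂Measure.pi ν) := by
        rw [← add_assoc]
        gcongr
      _ ≤ n * S + (S + ‖∫ p, g p ∂(μ 0).prod (Measure.pi ν)‖ₑ ^ 2) := by gcongr
      _ = _ := by push_cast; ring

theorem MemLp.integral_update {ι : Type*} [Fintype ι] [DecidableEq ι] {Ω : ι → Type*}
    [∀ i, MeasurableSpace (Ω i)] {μ : ∀ i, Measure (Ω i)} [∀ i, IsProbabilityMeasure (μ i)]
    {h : (∀ i, Ω i) → H} (hh : StronglyMeasurable h) (h2 : MemLp h 2 (Measure.pi μ)) (i : ι) :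
    MemLp (fun x => ∫ y, h (Function.update x i y) ∂μ i) 2 (Measure.pi μ) := by
  have hm := stronglyMeasurable_integral_update μ hh i
  rw [memLp_two_iff_lintegral_enorm_sq_lt_top hh.aestronglyMeasurable,
    ← (measurePreserving_update μ i).lintegral_comp (hh.enorm.pow_const 2),
    lintegral_prod (fun p => ‖h (Function.update p.1 i p.2)‖ₑ ^ 2)
      ((hh.enorm.pow_const 2).comp measurable_update').aemeasurable] at h2
  rw [memLp_two_iff_lintegral_enorm_sq_lt_top hm.aestronglyMeasurable]
  exact (lintegral_mono fun x => enorm_integral_sq_le _).trans_lt h2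

/-- **Efron–Stein inequality** for square-integrable functions with values in a Hilbert space. -/
theorem integral_sq_add_sum_marginal_sq_le {n : ℕ} {Ω : Fin n → Type*}
    [∀ i, MeasurableSpace (Ω i)] (μ : ∀ i, Measure (Ω i)) [∀ i, IsProbabilityMeasure (μ i)]
    {h : (∀ i, Ω i) → H} (hh : StronglyMeasurable h) (h2 : MemLp h 2 (Measure.pi μ)) :
    ∫ x, ‖h x‖ ^ 2 ∂Measure.pi μ
        + ∑ i, ∫ x, ‖∫ y, h (Function.update x i y) ∂μ i‖ ^ 2 ∂Measure.pi μ
      ≤ n * ∫ x, ‖h x‖ ^ 2 ∂Measure.pi μ + ‖∫ x, h x ∂Measure.pi μ‖ ^ 2 := by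
  have hS : 0 ≤ ∫ x, ‖h x‖ ^ 2 ∂Measure.pi μ := integral_nonneg fun _ => by positivity
  have hT : ∀ i, 0 ≤ ∫ x, ‖∫ y, h (Function.update x i y) ∂μ i‖ ^ 2 ∂Measure.pi μ :=
    fun i => integral_nonneg fun _ => by positivity
  rw [← ENNReal.ofReal_le_ofReal_iff (by positivity),
    ENNReal.ofReal_add hS (Finset.sum_nonneg fun i _ => hT i),
    ENNReal.ofReal_sum_of_nonneg fun i _ => hT i,
    ENNReal.ofReal_add (by positivity) (by positivity), ENNReal.ofReal_mul (by positivity),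
    ENNReal.ofReal_natCast, ofReal_integral_norm_sq h2,
    ENNReal.ofReal_pow (norm_nonneg _), ofReal_norm]
  simp_rw [fun i => ofReal_integral_norm_sq (MemLp.integral_update hh h2 i)]
  exact lintegral_sq_add_sum_marginal_sq_le μ hh

end Product

section MatrixExpectation

variable {Ω : Type*} [MeasurableSpace Ω] {μ : Measure Ω} {d : ℕ} {Z W : Ω → Mat d}

theorem expMat_isHermitian (hZ : ∀ x, (Z x).IsHermitian) : (expMat μ Z).IsHermitian := by
  ext j k
  simp only [expMat, Matrix.conjTranspose_apply, Matrix.of_apply, ← (hZ _).apply j k]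
  exact integral_conj.symm

theorem expMat_sub (hZ : MatIntegrable μ Z) (hW : MatIntegrable μ W) :
    expMat μ (fun x => Z x - W x) = expMat μ Z - expMat μ W := by
  ext j k
  exact integral_sub (hZ j k) (hW j k)

theorem expMat_mulVec_apply (hZ : MatIntegrable μ Z) (v : Fin d → ℂ) (j : Fin d) :
    (expMat μ Z).mulVec v j = ∫ x, (Z x).mulVec v j ∂μ := by
  simp only [Matrix.mulVec, dotProduct, expMat, Matrix.of_apply]
  rw [integral_finsetSum _ fun k _ => (hZ j k).mul_const _]
  simp_rw [integral_mul_const]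

theorem integrable_mulVec_apply (hZ : MatIntegrable μ Z) (v : Fin d → ℂ) (j : Fin d) :
    Integrable (fun x => (Z x).mulVec v j) μ := by
  simp only [Matrix.mulVec, dotProduct]
  exact integrable_finsetSum _ fun k _ => (hZ j k).mul_const _

theorem toLp_expMat_mulVec (hZ : MatIntegrable μ Z) (v : Fin d → ℂ) :
    WithLp.toLp 2 ((expMat μ Z).mulVec v) = ∫ x, WithLp.toLp 2 ((Z x).mulVec v) ∂μ := by
  ext j
  rw [eval_integral_piLp fun j => integrable_mulVec_apply hZ v j]
  exact expMat_mulVec_apply hZ v j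

theorem dotProduct_expMat_mulVec (hZ : MatIntegrable μ Z) (v : Fin d → ℂ) :
    star v ⬝ᵥ (expMat μ Z).mulVec v = ∫ x, star v ⬝ᵥ (Z x).mulVec v ∂μ := by
  simp only [dotProduct]
  rw [integral_finsetSum _ fun k _ => (integrable_mulVec_apply hZ v k).const_mul _]
  simp_rw [integral_const_mul, expMat_mulVec_apply hZ]

theorem dotProduct_sq_mulVec {A : Mat d} (hA : A.IsHermitian) (v : Fin d → ℂ) :
    star v ⬝ᵥ (A ^ 2).mulVec v = ((‖WithLp.toLp 2 (A.mulVec v)‖ ^ 2 : ℝ) : ℂ) := by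
  rw [pow_two, ← Matrix.mulVec_mulVec, Matrix.dotProduct_mulVec, ← hA.eq,
    ← Matrix.star_mulVec, hA.eq, EuclideanSpace.norm_sq_eq]
  simp [dotProduct, ← Complex.conj_mul']

theorem dotProduct_expMat_sq_mulVec (hH : ∀ x, (Z x).IsHermitian)
    (hZ : MatIntegrable μ fun x => Z x ^ 2) (v : Fin d → ℂ) :
    star v ⬝ᵥ (expMat μ fun x => Z x ^ 2).mulVec v
      = ((∫ x, ‖WithLp.toLp 2 ((Z x).mulVec v)‖ ^ 2 ∂μ : ℝ) : ℂ) := by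
  rw [dotProduct_expMat_mulVec hZ]
  simp_rw [dotProduct_sq_mulVec (hH _)]
  exact integral_ofReal

theorem norm_apply_sq_le_norm_sq_apply {A : Mat d} (hA : A.IsHermitian) (j k : Fin d) :
    ‖A j k‖ ^ 2 ≤ ‖(A ^ 2) j j‖ := by
  have h : (A ^ 2) j j = ((∑ l, ‖A j l‖ ^ 2 : ℝ) : ℂ) := by
    rw [pow_two, Matrix.mul_apply]
    push_cast
    refine Finset.sum_congr rfl fun l _ => ?_
    rw [← hA.apply l j, ← Complex.mul_conj']
    rfl
  rw [h, Complex.norm_real, Real.norm_of_nonneg (by positivity)]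
  exact Finset.single_le_sum (f := fun l => ‖A j l‖ ^ 2) (fun _ _ => by positivity)
    (Finset.mem_univ k)

theorem memLp_two_apply (hm : ∀ j k, AEStronglyMeasurable (fun x => Z x j k) μ)
    (hH : ∀ x, (Z x).IsHermitian) (hZ : MatIntegrable μ fun x => Z x ^ 2) (j k : Fin d) :
    MemLp (fun x => Z x j k) 2 μ := by
  rw [memLp_two_iff_integrable_sq_norm (hm j k)]
  refine (hZ j j).mono ((hm j k).norm.pow 2) (.of_forall fun x => ?_)
  rw [Real.norm_of_nonneg (by positivity)]
  exact norm_apply_sq_le_norm_sq_apply (hH x) j k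

theorem matIntegrable_sq (hZ : ∀ j k, MemLp (fun x => Z x j k) 2 μ) :
    MatIntegrable μ fun x => Z x ^ 2 := fun j k => by
  simp only [pow_two, Matrix.mul_apply]
  exact integrable_finsetSum _ fun l _ => (hZ j l).integrable_mul (hZ l k)

end MatrixExpectation

section Marginal

variable {ι : Type*} [Fintype ι] [DecidableEq ι] {Ω : ι → Type*} [∀ i, MeasurableSpace (Ω i)]
  {μ : ∀ i, Measure (Ω i)} [∀ i, IsProbabilityMeasure (μ i)] {d : ℕ} {Z : (∀ i, Ω i) → Mat d}

theorem MatIntegrable.comp_update (hZ : MatIntegrable (Measure.pi μ) Z) (i : ι) (j k : Fin d) :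
    Integrable (fun p : (∀ i, Ω i) × Ω i => Z (Function.update p.1 i p.2) j k)
      ((Measure.pi μ).prod (μ i)) :=
  (measurePreserving_update μ i).integrable_comp_of_integrable (hZ j k)

theorem MatIntegrable.expMat_update (hZ : MatIntegrable (Measure.pi μ) Z) (i : ι) :
    MatIntegrable (Measure.pi μ) fun x => expMat (μ i) fun y => Z (Function.update x i y) :=
  fun j k => (hZ.comp_update i j k).integral_prod_left

theorem MatIntegrable.ae_update (hZ : MatIntegrable (Measure.pi μ) Z) (i : ι) :
    ∀ᵐ x ∂Measure.pi μ, MatIntegrable (μ i) fun y => Z (Function.update x i y) := by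
  simp only [MatIntegrable, ae_all_iff]
  exact fun j k => (hZ.comp_update i j k).prod_right_ae

theorem expMat_expMat_update (hZ : MatIntegrable (Measure.pi μ) Z) (i : ι) :
    expMat (Measure.pi μ) (fun x => expMat (μ i) fun y => Z (Function.update x i y))
      = expMat (Measure.pi μ) Z := by
  ext j k
  have hmap := (measurePreserving_update μ i).map_eq
  have hint : AEStronglyMeasurable (fun x => Z x j k)
      (((Measure.pi μ).prod (μ i)).map fun p => Function.update p.1 i p.2) :=
    hmap.symm ▸ (hZ j k).aestronglyMeasurable
  have h := integral_map measurable_update'.aemeasurable hint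
  rw [hmap, integral_prod _ (hZ.comp_update i j k)] at h
  exact h.symm

end Marginal

/-- **Subadditivity of the operator-valued variance.**
Independence of `X₁, …, Xₙ` is modelled by the product probability space `Π i, Ω i`
with the product measure; `E_i` is integration over the `i`-th coordinate only. -/
theorem operator_variance_subadditive {d n : ℕ} {Ω : Fin n → Type*}
    [∀ i, MeasurableSpace (Ω i)]
    (μ : ∀ i, Measure (Ω i)) [∀ i, IsProbabilityMeasure (μ i)]
    (f : (∀ i, Ω i) → Mat d)
    (hmeas : ∀ i j, Measurable fun x => f x i j)
    (hpsd : ∀ x, (f x).PosSemidef)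
    (hint : MatIntegrable (Measure.pi μ) f)
    (hint2 : MatIntegrable (Measure.pi μ) (fun x => f x ^ 2)) :
    LoewnerLE
      (expMat (Measure.pi μ) (fun x => f x ^ 2) - (expMat (Measure.pi μ) f) ^ 2)
      (∑ i : Fin n, expMat (Measure.pi μ) (fun x =>
        expMat (μ i) (fun y => f (Function.update x i y) ^ 2)
          - (expMat (μ i) (fun y => f (Function.update x i y))) ^ 2)) := by
  have hH : ∀ x, (f x).IsHermitian := fun x => (hpsd x).isHermitian
  have hf2 : ∀ j k, MemLp (fun x => f x j k) 2 (Measure.pi μ) :=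
    memLp_two_apply (fun j k => (hmeas j k).aestronglyMeasurable) hH hint2
  set N : ∀ i : Fin n, (∀ i, Ω i) → Mat d :=
    fun i x => expMat (μ i) fun y => f (Function.update x i y) with hN
  have hNH : ∀ i x, (N i x).IsHermitian := fun i x => expMat_isHermitian fun y => hH _
  have hN2 : ∀ i, MatIntegrable (Measure.pi μ) fun x => N i x ^ 2 := fun i =>
    matIntegrable_sq fun j k => MemLp.integral_update (hmeas j k).stronglyMeasurable (hf2 j k) i
  have hterm : ∀ i, expMat (Measure.pi μ) (fun x =>
      expMat (μ i) (fun y => f (Function.update x i y) ^ 2) - N i x ^ 2)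
      = expMat (Measure.pi μ) (fun x => f x ^ 2) - expMat (Measure.pi μ) fun x => N i x ^ 2 :=
    fun i => by
      rw [expMat_sub (hint2.expMat_update i) (hN2 i), expMat_expMat_update hint2]
  have hEH := expMat_isHermitian (μ := Measure.pi μ) hH
  have hE2H := expMat_isHermitian (μ := Measure.pi μ) fun x => (hH x).pow 2
  have hN2H := fun i => expMat_isHermitian (μ := Measure.pi μ) fun x => (hNH i x).pow 2
  change (∑ i, expMat (Measure.pi μ) (fun x =>
    expMat (μ i) (fun y => f (Function.update x i y) ^ 2) - N i x ^ 2) - _).PosSemidef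
  simp only [hterm]
  refine .of_dotProduct_mulVec_nonneg ?_ fun v => ?_
  · refine .sub ?_ (hE2H.sub (hEH.pow 2))
    exact isSelfAdjoint_sum _ fun i _ => hE2H.sub (hN2H i)
  have hgm : StronglyMeasurable fun x => WithLp.toLp 2 ((f x).mulVec v) := by
    refine Measurable.stronglyMeasurable ((WithLp.measurable_toLp 2 _).comp ?_)
    refine measurable_pi_lambda _ fun j => ?_
    simp only [Matrix.mulVec, dotProduct]
    exact Finset.measurable_sum _ fun k _ =>
      (hmeas j k).mul_const _
  have hg2 : MemLp (fun x => WithLp.toLp 2 ((f x).mulVec v)) 2 (Measure.pi μ) := by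
    refine .of_eval_piLp fun j => ?_
    simp only [Matrix.mulVec, dotProduct]
    exact memLp_finsetSum _ fun k _ => (hf2 j k).mul_const _
  have hNv : ∀ i, ∫ x, ‖WithLp.toLp 2 ((N i x).mulVec v)‖ ^ 2 ∂Measure.pi μ
      = ∫ x, ‖∫ y, WithLp.toLp 2 ((f (Function.update x i y)).mulVec v) ∂μ i‖ ^ 2
        ∂Measure.pi μ := fun i => by
    refine integral_congr_ae ?_
    filter_upwards [hint.ae_update i] with x hx
    rw [hN, toLp_expMat_mulVec hx]
  have key := integral_sq_add_sum_marginal_sq_le μ hgm hg2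
  simp only [Matrix.sub_mulVec, Matrix.sum_mulVec, dotProduct_sub, dotProduct_sum,
    dotProduct_expMat_sq_mulVec hH hint2, dotProduct_expMat_sq_mulVec (hNH _) (hN2 _),
    dotProduct_sq_mulVec hEH, hNv, toLp_expMat_mulVec hint]
  simp only [Finset.sum_sub_distrib, Finset.sum_const, Finset.card_univ, Fintype.card_fin,
    nsmul_eq_mul]
  convert! Complex.zero_le_real.2 (sub_nonneg.2 key) using 1
  push_cast
  ring
end
end

section
/- Equivalence of convexity of the matrix Φ-entropy functional and the conditional Jensen inequality: Let Φ : [0,∞) → ℝ be convex. The following are equivalent: (i) for all random d×d positive semidefinite matrices X, Y defined on a common probability space (with the relevant Bochner integrability) and all t ∈ [0,1], H_Φ(t·X + (1−t)·Y) ≤ t·H_Φ(X) + (1−t)·H_Φ(Y); (ii) for every pair of independent random variables (X₁,X₂) on a product probability space and every d×d positive semidefinite random matrix Z = Z(X₁,X₂) with Z and Φ(Z) Bochner integrable, E₁[ tr(E₂Φ(Z) − Φ(E₂Z)) ] ≥ tr[E₂Φ(E₁Z) − Φ(E Z)], i.e. E₁[H_Φ(Z|X₁)] ≥ H_Φ(E₁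 Z), where E₁ and E₂ denote integration over the first and second coordinate respectively. -/
open MeasureTheory
open scoped ComplexOrder

noncomputable section

/-- The standard matrix function induced by `Φ : ℝ → ℝ` on Hermitian matrices, obtained by
applying `Φ` to the eigenvalues in a spectral decomposition (junk value `0` off the
Hermitian matrices). -/
def matFun {d : ℕ} (Φ : ℝ → ℝ) (A : Mat d) : Mat d :=
  if hA : A.IsHermitian then
    (hA.eigenvectorUnitary : Mat d) *
      Matrix.diagonal (fun i => (Φ (hA.eigenvalues i) : ℂ)) *
      (star (hA.eigenvectorUnitary : Mat d))
  else 0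

theorem matFun_isHermitian {d : ℕ} (Φ : ℝ → ℝ) (A : Mat d) : (matFun Φ A).IsHermitian := by
  unfold matFun
  split
  · rename_i hA
    rw [Matrix.star_eq_conjTranspose]
    exact Matrix.isHermitian_mul_mul_conjTranspose _ (by
      rw [Matrix.IsHermitian, Matrix.diagonal_conjTranspose]
      have hstar : (star fun i => ((Φ (hA.eigenvalues i) : ℝ) : ℂ))
          = fun i => ((Φ (hA.eigenvalues i) : ℝ) : ℂ) :=
        funext fun i => Complex.conj_ofReal _
      rw [hstar])
  · exact Matrix.isHermitian_zero


/-- The normalized trace `tr[M] = Tr[M] / d` (real part; the trace of a Hermitian matrix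
is real). -/
def ntr {d : ℕ} (M : Mat d) : ℝ := (Matrix.trace M).re / d

/-- Real part of the (unnormalized) trace. -/
def TrRe {d : ℕ} (M : Mat d) : ℝ := (Matrix.trace M).re

/-- Convexity of the matrix `Φ`-entropy functional `H_Φ`: for all random positive semidefinite
matrices `X`, `Y` on a common probability space (with the relevant Bochner integrability)
and all `t ∈ [0,1]`, `H_Φ(tX + (1−t)Y) ≤ t H_Φ(X) + (1−t) H_Φ(Y)`. -/
def EntropyConvex (d : ℕ) (Φ : ℝ → ℝ) : Prop :=
  ∀ (Ω : Type) (_ : MeasurableSpace Ω) (μ : Measure Ω), IsProbabilityMeasure μ →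
    ∀ X Y : Ω → Mat d,
      (∀ i j, Measurable fun ω => X ω i j) → (∀ i j, Measurable fun ω => Y ω i j) →
      (∀ ω, (X ω).PosSemidef) → (∀ ω, (Y ω).PosSemidef) →
      MatIntegrable μ X → MatIntegrable μ Y →
      MatIntegrable μ (fun ω => matFun Φ (X ω)) →
      MatIntegrable μ (fun ω => matFun Φ (Y ω)) →
      ∀ t : ℝ, t ∈ Set.Icc (0 : ℝ) 1 →
      MatIntegrable μ (fun ω => matFun Φ (t • X ω + (1 - t) • Y ω)) →
      ntr (expMat μ (fun ω => matFun Φ (t • X ω + (1 - t) • Y ω))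
            - matFun Φ (expMat μ (fun ω => t • X ω + (1 - t) • Y ω)))
        ≤ t * ntr (expMat μ (fun ω => matFun Φ (X ω)) - matFun Φ (expMat μ X))
          + (1 - t) * ntr (expMat μ (fun ω => matFun Φ (Y ω)) - matFun Φ (expMat μ Y))

/-- The conditional Jensen inequality for the matrix `Φ`-entropy functional:
`E₁[H_Φ(Z | X₁)] ≥ H_Φ(E₁ Z)` for every pair of independent random variables `(X₁, X₂)`
(modelled by a product probability space) and every positive semidefinite random matrix
`Z = Z(X₁, X₂)` with `Z` and `Φ(Z)` Bochner integrable. -/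
def ConditionalJensen (d : ℕ) (Φ : ℝ → ℝ) : Prop :=
  ∀ (Ω₁ Ω₂ : Type) (_ : MeasurableSpace Ω₁) (_ : MeasurableSpace Ω₂)
    (μ₁ : Measure Ω₁) (μ₂ : Measure Ω₂),
    IsProbabilityMeasure μ₁ → IsProbabilityMeasure μ₂ →
    ∀ Z : Ω₁ × Ω₂ → Mat d,
      (∀ i j, Measurable fun ω => Z ω i j) →
      (∀ ω, (Z ω).PosSemidef) →
      MatIntegrable (μ₁.prod μ₂) Z →
      MatIntegrable (μ₁.prod μ₂) (fun ω => matFun Φ (Z ω)) →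
      (∫ x₁, ntr (expMat μ₂ (fun x₂ => matFun Φ (Z (x₁, x₂)))
          - matFun Φ (expMat μ₂ (fun x₂ => Z (x₁, x₂)))) ∂μ₁)
        ≥ ntr (expMat μ₂ (fun x₂ => matFun Φ (expMat μ₁ (fun x₁ => Z (x₁, x₂))))
            - matFun Φ (expMat (μ₁.prod μ₂) Z))

theorem matFun_of_isHermitian {d : ℕ} (Φ : ℝ → ℝ) {A : Mat d} (hA : A.IsHermitian) :
    matFun Φ A = (hA.eigenvectorUnitary : Mat d) *
      Matrix.diagonal (fun i => (Φ (hA.eigenvalues i) : ℂ)) *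
      (star (hA.eigenvectorUnitary : Mat d)) := by
  rw [matFun, dif_pos hA]

theorem matFun_eq_cfc {d : ℕ} (Φ : ℝ → ℝ) {A : Mat d} (hA : A.IsHermitian) :
    matFun Φ A = cfc Φ A := by
  rw [hA.cfc_eq, matFun_of_isHermitian Φ hA, Matrix.IsHermitian.cfc,
    Unitary.conjStarAlgAut_apply]
  rfl

theorem matFun_congr {d : ℕ} {Φ Ψ : ℝ → ℝ} (h : Set.EqOn Φ Ψ (Set.Ici 0)) {A : Mat d}
    (hA : A.PosSemidef) : matFun Φ A = matFun Ψ A := by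
  rw [matFun_of_isHermitian Φ hA.1, matFun_of_isHermitian Ψ hA.1]
  simp only [h (show _ ∈ Set.Ici (0 : ℝ) from hA.eigenvalues_nonneg _)]

theorem trace_matFun {d : ℕ} (Φ : ℝ → ℝ) {A : Mat d} (hA : A.IsHermitian) :
    (matFun Φ A).trace = ((∑ i, Φ (hA.eigenvalues i) : ℝ) : ℂ) := by
  rw [matFun_of_isHermitian Φ hA, Matrix.trace_mul_cycle, Unitary.coe_star_mul_self, one_mul,
    Matrix.trace_diagonal]
  push_cast
  rfl

theorem ntr_matFun {d : ℕ} (Φ : ℝ → ℝ) {A : Mat d} (hA : A.IsHermitian) :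
    ntr (matFun Φ A) = (∑ i, Φ (hA.eigenvalues i)) / d := by
  rw [ntr, trace_matFun Φ hA, Complex.ofReal_re]

theorem ntr_eq_sum_eigenvalues {d : ℕ} {A : Mat d} (hA : A.IsHermitian) :
    ntr A = (∑ i, hA.eigenvalues i) / d := by
  rw [ntr, hA.trace_eq_sum_eigenvalues]
  simp

theorem ntr_sub {d : ℕ} (A B : Mat d) : ntr (A - B) = ntr A - ntr B := by
  simp [ntr, sub_div]

theorem ntr_smul {d : ℕ} (c : ℝ) (A : Mat d) : ntr (c • A) = c * ntr A := by
  simp [ntr, mul_div_assoc]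

theorem posSemidef_real_smul {d : ℕ} {A : Mat d} (hA : A.PosSemidef) {c : ℝ} (hc : 0 ≤ c) :
    (c • A).PosSemidef := hA.smul hc

theorem convex_posSemidef (d : ℕ) : Convex ℝ {A : Mat d | A.PosSemidef} := by
  intro A hA B hB a b ha hb _
  exact (posSemidef_real_smul hA ha).add (posSemidef_real_smul hB hb)

theorem isClosed_posSemidef (d : ℕ) : IsClosed {A : Mat d | A.PosSemidef} := by
  have : {A : Mat d | A.PosSemidef} = {A : Mat d | A.conjTranspose = A} ∩
      ⋂ x : Fin d → ℂ, {A : Mat d | 0 ≤ dotProduct (star x) (A.mulVec x)} := by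
    ext A
    simp only [Matrix.posSemidef_iff_dotProduct_mulVec, Set.mem_ofPred_eq, Set.mem_inter_iff,
      Set.mem_iInter, Matrix.IsHermitian]
  rw [this]
  refine (isClosed_eq (by fun_prop) continuous_id).inter (isClosed_iInter fun x => ?_)
  exact isClosed_le continuous_const (by fun_prop)

/-- The diagonal of a diagonal matrix conjugated by a unitary matrix consists of averages. -/
theorem re_conj_diagonal_apply {d : ℕ} (W : Mat d) (c : Fin d → ℝ) (i : Fin d) :
    ((W * Matrix.diagonal (fun j => (c j : ℂ)) * star W) i i).re
      = ∑ j, Complex.normSq (W i j) * c j := by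
  rw [Matrix.mul_apply, Complex.re_sum]
  refine Finset.sum_congr rfl fun j _ => ?_
  rw [Matrix.mul_diagonal, Matrix.star_apply, mul_right_comm, Complex.star_def,
    Complex.mul_conj, ← Complex.ofReal_mul, Complex.ofReal_re]

theorem sum_normSq_row {d : ℕ} {W : Mat d} (hW : W * star W = 1) (i : Fin d) :
    ∑ j, Complex.normSq (W i j) = 1 := by
  have := re_conj_diagonal_apply W 1 i
  simpa [hW] using this.symm

theorem sum_normSq_col {d : ℕ} {W : Mat d} (hW : star W * W = 1) (j : Fin d) :
    ∑ i, Complex.normSq (W i j) = 1 := by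
  have := sum_normSq_row (W := star W) (by simpa using hW) j
  simpa using this

/-- **Peierls' inequality** for a convex function of a positive semidefinite matrix. -/
theorem sum_diag_le_trace_matFun {d : ℕ} {Φ : ℝ → ℝ} (hΦ : ConvexOn ℝ (Set.Ici (0 : ℝ)) Φ)
    {X : Mat d} (hX : X.PosSemidef) (U : Matrix.unitaryGroup (Fin d) ℂ) :
    ∑ i, Φ ((star (U : Mat d) * X * (U : Mat d)) i i).re ≤ (matFun Φ X).trace.re := by
  set V := hX.1.eigenvectorUnitary with hV
  set W : Matrix.unitaryGroup (Fin d) ℂ := star U * V with hW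
  have hW1 : (W : Mat d) * star (W : Mat d) = 1 := Unitary.coe_mul_star_self W
  have hW2 : star (W : Mat d) * (W : Mat d) = 1 := Unitary.coe_star_mul_self W
  have key : star (U : Mat d) * X * (U : Mat d) =
      (W : Mat d) * Matrix.diagonal (fun j => (hX.1.eigenvalues j : ℂ)) * star (W : Mat d) := by
    conv_lhs => rw [hX.1.spectral_theorem, Unitary.conjStarAlgAut_apply]
    have hWc : (W : Mat d) = star (U : Mat d) * (V : Mat d) := rfl
    rw [hWc, star_mul, star_star]
    simp only [mul_assoc]
    rfl
  rw [key, trace_matFun Φ hX.1, Complex.ofReal_re]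
  calc _ ≤ ∑ i, ∑ j, Complex.normSq ((W : Mat d) i j) * Φ (hX.1.eigenvalues j) := by
        refine Finset.sum_le_sum fun i _ => ?_
        rw [re_conj_diagonal_apply]
        have := hΦ.map_sum_le (t := Finset.univ) (w := fun j => Complex.normSq ((W : Mat d) i j))
          (p := hX.1.eigenvalues) (fun j _ => Complex.normSq_nonneg _) (sum_normSq_row hW1 i)
          (fun j _ => hX.eigenvalues_nonneg j)
        simpa only [smul_eq_mul] using this
    _ = ∑ j, Φ (hX.1.eigenvalues j) := by
        rw [Finset.sum_comm]
        refine Finset.sum_congr rfl fun j _ => ?_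
        rw [← Finset.sum_mul, sum_normSq_col hW2, one_mul]

theorem convexOn_ntr_matFun (d : ℕ) {Φ : ℝ → ℝ} (hΦ : ConvexOn ℝ (Set.Ici (0 : ℝ)) Φ) :
    ConvexOn ℝ {A : Mat d | A.PosSemidef} (fun A => ntr (matFun Φ A)) := by
  refine ⟨convex_posSemidef d, fun X hX Y hY a b ha hb hab => ?_⟩
  have hA : (a • X + b • Y).PosSemidef := convex_posSemidef d hX hY ha hb hab
  set U := hA.1.eigenvectorUnitary
  have hdiag (i) : hA.1.eigenvalues i =
      a * ((star (U : Mat d) * X * (U : Mat d)) i i).re +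
      b * ((star (U : Mat d) * Y * (U : Mat d)) i i).re := by
    have h := hA.1.conjStarAlgAut_star_eigenvectorUnitary
    rw [Unitary.conjStarAlgAut_star_apply] at h
    have h' := congrArg (fun M : Mat d => (M i i).re) h
    simp only [Matrix.mul_add, Matrix.add_mul, Matrix.mul_smul, Matrix.smul_mul, Matrix.add_apply,
      Matrix.smul_apply, Complex.add_re, Complex.smul_re, Matrix.diagonal_apply_eq,
      Function.comp_apply, smul_eq_mul] at h'
    exact h'.symm
  have hnn {M : Mat d} (hM : M.PosSemidef) (i) :
      0 ≤ ((star (U : Mat d) * M * (U : Mat d)) i i).re := by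
    have := hM.conjTranspose_mul_mul_same (U : Mat d)
    exact (Complex.le_def.1 (this.diag_nonneg (i := i))).1
  have hsum : (matFun Φ (a • X + b • Y)).trace.re ≤
      a * (matFun Φ X).trace.re + b * (matFun Φ Y).trace.re := by
    rw [trace_matFun Φ hA.1, Complex.ofReal_re]
    calc _ ≤ ∑ i, (a * Φ ((star (U : Mat d) * X * (U : Mat d)) i i).re +
          b * Φ ((star (U : Mat d) * Y * (U : Mat d)) i i).re) := by
          refine Finset.sum_le_sum fun i _ => ?_
          rw [hdiag i]
          exact hΦ.2 (hnn hX i) (hnn hY i) ha hb hab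
      _ ≤ _ := by
          rw [Finset.sum_add_distrib, ← Finset.mul_sum, ← Finset.mul_sum]
          exact add_le_add
            (mul_le_mul_of_nonneg_left (sum_diag_le_trace_matFun hΦ hX U) ha)
            (mul_le_mul_of_nonneg_left (sum_diag_le_trace_matFun hΦ hY U) hb)
  simp only [ntr, smul_eq_mul]
  rw [← mul_div_assoc, ← mul_div_assoc, ← add_div]
  exact div_le_div_of_nonneg_right hsum (Nat.cast_nonneg d)

theorem exists_affine_le_ntr_matFun (d : ℕ) [NeZero d] {Φ : ℝ → ℝ} {a b : ℝ}
    (h : ∀ x ∈ Set.Ici (0 : ℝ), a * x + b ≤ Φ x) {A : Mat d} (hA : A.PosSemidef) :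
    a * ntr A + b ≤ ntr (matFun Φ A) := by
  have hd : (0 : ℝ) < d := Nat.cast_pos.2 (NeZero.pos d)
  rw [ntr_matFun Φ hA.1, ntr_eq_sum_eigenvalues hA.1, ← mul_div_assoc, div_add' _ _ _ hd.ne']
  refine div_le_div_of_nonneg_right ?_ hd.le
  calc _ = ∑ i, (a * hA.1.eigenvalues i + b) := by
        simp [Finset.sum_add_distrib, Finset.mul_sum, mul_comm]
    _ ≤ _ := Finset.sum_le_sum fun i _ => h _ (hA.eigenvalues_nonneg i)

theorem norm_matFun_apply_le {d : ℕ} [NeZero d] {Φ : ℝ → ℝ} {a b : ℝ}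
    (h : ∀ x ∈ Set.Ici (0 : ℝ), a * x + b ≤ Φ x) {A : Mat d} (hA : A.PosSemidef) (i j : Fin d) :
    ‖matFun Φ A i j‖ ≤ d * (ntr (matFun Φ A) + 2 * |a| * ntr A + 2 * |b|) := by
  have hd : (d : ℝ) ≠ 0 := Nat.cast_ne_zero.2 (NeZero.ne d)
  have hentry : ‖matFun Φ A i j‖ ≤ ∑ k, |Φ (hA.1.eigenvalues k)| := by
    rw [matFun_of_isHermitian Φ hA.1, Matrix.mul_apply]
    refine (norm_sum_le _ _).trans (Finset.sum_le_sum fun k _ => ?_)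
    rw [Matrix.mul_diagonal, Matrix.star_apply, norm_mul, norm_mul, norm_star, Complex.norm_real,
      Real.norm_eq_abs]
    have h1 := entry_norm_bound_of_unitary hA.1.eigenvectorUnitary.2 i k
    have h2 := entry_norm_bound_of_unitary hA.1.eigenvectorUnitary.2 j k
    have h0 := abs_nonneg (Φ (hA.1.eigenvalues k))
    calc _ ≤ 1 * |Φ (hA.1.eigenvalues k)| * 1 := by gcongr
      _ = _ := by ring
  refine hentry.trans ?_
  rw [ntr_matFun Φ hA.1, ntr_eq_sum_eigenvalues hA.1]
  calc _ ≤ ∑ k, (Φ (hA.1.eigenvalues k) + 2 * |a| * hA.1.eigenvalues k + 2 * |b|) := by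
        refine Finset.sum_le_sum fun k _ => ?_
        have h0 : 0 ≤ hA.1.eigenvalues k := hA.eigenvalues_nonneg k
        have h1 := h _ h0
        have h2 := neg_abs_le b
        have h3 := mul_le_mul_of_nonneg_right (neg_abs_le a) h0
        have h4 := abs_nonneg b
        have h5 := mul_nonneg (abs_nonneg a) h0
        rw [abs_le]
        constructor <;> nlinarith
    _ = _ := by
        rw [Finset.sum_add_distrib, Finset.sum_add_distrib, ← Finset.mul_sum]
        simp only [Finset.sum_const, Finset.card_univ, Fintype.card_fin, nsmul_eq_mul]
        field_simp

section

open scoped Matrix.Norms.L2Operator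

/-- On positive semidefinite matrices, `matFun Φ` agrees with a globally continuous function. -/
theorem exists_continuous_eq_matFun (d : ℕ) {Φ : ℝ → ℝ} (hΦ : ContinuousOn Φ (Set.Ici 0)) :
    ∃ G : Mat d → Mat d, Continuous G ∧ ∀ A : Mat d, A.PosSemidef → G A = matFun Φ A := by
  have hc : Continuous fun x : ℝ => Φ (max x 0) :=
    hΦ.comp_continuous (by fun_prop) fun x => le_max_right x 0
  refine ⟨fun A => cfc (fun x : ℝ => Φ (max x 0)) ((2⁻¹ : ℝ) • (A + A.conjTranspose)), ?_, ?_⟩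
  · rw [← continuousOn_univ]
    refine ContinuousOn.cfc_of_mem_nhdsSet (s := Set.univ) _ Filter.univ_mem (by fun_prop) ?_
      hc.continuousOn
    intro A _
    exact (IsSelfAdjoint.all (2⁻¹ : ℝ)).smul (IsSelfAdjoint.add_star_self A)
  · intro A hA
    have h1 : (2⁻¹ : ℝ) • (A + A.conjTranspose) = A := by
      rw [hA.1.eq, ← two_smul ℝ A, smul_smul]
      norm_num
    simp only [h1]
    rw [← matFun_eq_cfc _ hA.1]
    exact matFun_congr (fun x hx => by simp [max_eq_left (show (0 : ℝ) ≤ x from hx)]) hA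

end

/-- The probability measure on `Bool` with mass `t` at `true` and `1 - t` at `false`. -/
def twoPoint (t : ℝ) : Measure Bool :=
  ENNReal.ofReal t • Measure.dirac true + ENNReal.ofReal (1 - t) • Measure.dirac false

theorem isProbabilityMeasure_twoPoint {t : ℝ} (ht : t ∈ Set.Icc (0 : ℝ) 1) :
    IsProbabilityMeasure (twoPoint t) := by
  constructor
  simp [twoPoint, ← ENNReal.ofReal_add ht.1 (sub_nonneg.2 ht.2)]

instance isFiniteMeasure_twoPoint (t : ℝ) : IsFiniteMeasure (twoPoint t) := by
  constructor
  simp [twoPoint]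

theorem integral_twoPoint {E : Type*} [NormedAddCommGroup E] [NormedSpace ℝ E] [CompleteSpace E]
    {t : ℝ} (ht : t ∈ Set.Icc (0 : ℝ) 1) (g : Bool → E) :
    ∫ b, g b ∂(twoPoint t) = t • g true + (1 - t) • g false := by
  have hfin (c : ℝ) (b : Bool) : IsFiniteMeasure (ENNReal.ofReal c • Measure.dirac b) := by
    constructor
    simp
  rw [twoPoint, integral_add_measure .of_finite .of_finite, integral_smul_measure,
    integral_smul_measure, integral_dirac, integral_dirac, ENNReal.toReal_ofReal ht.1,
    ENNReal.toReal_ofReal (sub_nonneg.2 ht.2)]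

theorem expMat_twoPoint {d : ℕ} {t : ℝ} (ht : t ∈ Set.Icc (0 : ℝ) 1) (Z : Bool → Mat d) :
    expMat (twoPoint t) Z = t • Z true + (1 - t) • Z false := by
  ext i j
  simp only [expMat, Matrix.of_apply, integral_twoPoint ht]
  rfl

theorem integrable_twoPoint_prod {Ω : Type*} [MeasurableSpace Ω] (μ : Measure Ω) [SFinite μ]
    (t : ℝ) {g : Bool × Ω → ℂ} (h : ∀ b, Integrable (fun ω => g (b, ω)) μ) :
    Integrable g ((twoPoint t).prod μ) := by
  have hb (b : Bool) : Integrable g ((Measure.dirac b).prod μ) := by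
    rw [Measure.dirac_prod, (measurableEmbedding_prodMk_left b).integrable_map_iff]
    exact h b
  rw [twoPoint, Measure.add_prod, Measure.prod_smul_left, Measure.prod_smul_left]
  exact ((hb true).smul_measure ENNReal.ofReal_ne_top).add_measure
    ((hb false).smul_measure ENNReal.ofReal_ne_top)

theorem ConditionalJensen.entropyConvex {d : ℕ} {Φ : ℝ → ℝ} (h : ConditionalJensen d Φ) :
    EntropyConvex d Φ := by
  intro Ω _ μ _ X Y hXm hYm hX hY hXi hYi hΦX hΦY t ht _
  have := isProbabilityMeasure_twoPoint ht
  let Z : Bool × Ω → Mat d := fun p => bif p.1 then X p.2 else Y p.2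
  have hZi : MatIntegrable ((twoPoint t).prod μ) Z := fun i j =>
    integrable_twoPoint_prod μ t fun b => by cases b; exacts [hYi i j, hXi i j]
  have hΦZ : MatIntegrable ((twoPoint t).prod μ) fun p => matFun Φ (Z p) := fun i j =>
    integrable_twoPoint_prod μ t fun b => by cases b; exacts [hΦY i j, hΦX i j]
  have key := h Bool Ω _ _ (twoPoint t) μ this inferInstance Z
    (fun i j => measurable_from_prod_countable_right fun b => by
      cases b; exacts [hYm i j, hXm i j])
    (fun p => by obtain ⟨b, ω⟩ := p; cases b; exacts [hY ω, hX ω]) hZi hΦZ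
  rw [integral_twoPoint ht] at key
  have hE : expMat ((twoPoint t).prod μ) Z = expMat μ fun ω => t • X ω + (1 - t) • Y ω := by
    ext i j
    simp only [expMat, Matrix.of_apply]
    rw [integral_prod_symm _ (hZi i j)]
    refine integral_congr_ae (.of_forall fun ω => ?_)
    simp only [integral_twoPoint ht]
    rfl
  simp only [expMat_twoPoint ht, hE] at key
  exact key

theorem matFun_smul_one {d : ℕ} (Φ : ℝ → ℝ) (x : ℝ) :
    matFun Φ (x • (1 : Mat d)) = Φ x • (1 : Mat d) := by
  rw [matFun_eq_cfc Φ ((IsSelfAdjoint.all x).smul (IsSelfAdjoint.one (Mat d))),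
    ← Algebra.algebraMap_eq_smul_one, cfc_algebraMap, Algebra.algebraMap_eq_smul_one]

theorem ntr_one (d : ℕ) [NeZero d] : ntr (1 : Mat d) = 1 := by
  simp [ntr, Matrix.trace_one, NeZero.ne d]

/-- Convexity of the entropy on scalar two-point random matrices. -/
theorem EntropyConvex.scalar_twoPoint {d : ℕ} [NeZero d] {Φ : ℝ → ℝ} (h : EntropyConvex d Φ)
    {x : ℝ} (hx : 0 ≤ x) :
    2⁻¹ * Φ x + 2⁻¹ * Φ 0 - Φ (2⁻¹ * x) ≤
      2⁻¹ * (2⁻¹ * Φ (2 * x) + 2⁻¹ * Φ 0 - Φ x) := by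
  have ht : (2⁻¹ : ℝ) ∈ Set.Icc (0 : ℝ) 1 := by constructor <;> norm_num
  have h1 : (1 - 2⁻¹ : ℝ) = 2⁻¹ := by norm_num
  have hps {c : ℝ} (hc : 0 ≤ c) : (c • (1 : Mat d)).PosSemidef :=
    posSemidef_real_smul Matrix.PosSemidef.one hc
  have hint (W : Bool → Mat d) : MatIntegrable (twoPoint 2⁻¹) W := fun _ _ => .of_finite
  have key := h Bool _ (twoPoint 2⁻¹) (isProbabilityMeasure_twoPoint ht)
    (fun _ => (0 : ℝ) • (1 : Mat d)) (fun b => (bif b then 2 * x else 0 : ℝ) • (1 : Mat d))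
    (fun _ _ => measurable_from_top) (fun _ _ => measurable_from_top)
    (fun _ => hps le_rfl) (fun b => hps (by cases b <;> simp [hx]))
    (hint _) (hint _) (hint _) (hint _) 2⁻¹ ht (hint _)
  simp only [expMat_twoPoint ht, h1, smul_smul, ← add_smul, matFun_smul_one, ntr_sub, ntr_smul,
    ntr_one, cond_true, cond_false] at key
  ring_nf at key ⊢
  linarith

theorem ConvexOn.continuousOn_Ici_of_scalar_twoPoint {Φ : ℝ → ℝ}
    (hΦ : ConvexOn ℝ (Set.Ici (0 : ℝ)) Φ)
    (h : ∀ x, 0 ≤ x → 2⁻¹ * Φ x + 2⁻¹ * Φ 0 - Φ (2⁻¹ * x) ≤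
      2⁻¹ * (2⁻¹ * Φ (2 * x) + 2⁻¹ * Φ 0 - Φ x)) :
    ContinuousOn Φ (Set.Ici 0) := by
  refine hΦ.continuousOn_Ici ?_
  have h01 {x : ℝ} (hx : 0 ≤ x) (hx1 : x < 1) : slope Φ 1 0 ≤ slope Φ 1 x :=
    hΦ.slope_mono (x := 1) (by simp) (by simp) (by simp [hx, hx1.ne]) hx
  have hmono : MonotoneOn (slope Φ 1) (Set.Ioo 0 1) := fun x hx y hy hxy =>
    hΦ.slope_mono (x := 1) (by simp) (by simp [hx.1.le, hx.2.ne]) (by simp [hy.1.le, hy.2.ne]) hxy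
  obtain ⟨l, hl⟩ : ∃ l, Filter.Tendsto Φ (nhdsWithin 0 (Set.Ioi 0)) (nhds l) := by
    have := hmono.tendsto_nhdsWithin_Ioo_right (by simp)
      ⟨slope Φ 1 0, by rintro _ ⟨x, hx, rfl⟩; exact h01 hx.1.le hx.2⟩
    have h2 : Filter.Tendsto (fun x : ℝ => x - 1) (nhdsWithin 0 (Set.Ioi 0)) (nhds (0 - 1)) :=
      tendsto_nhdsWithin_of_tendsto_nhds ((continuous_sub_right 1).tendsto 0)
    refine ⟨_, ((h2.mul this).add_const (Φ 1)).congr fun x => ?_⟩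
    rw [← smul_eq_mul, sub_smul_slope]
    simp
  have hscale {c : ℝ} (hc : 0 < c) :
      Filter.Tendsto (fun x => Φ (c * x)) (nhdsWithin 0 (Set.Ioi 0)) (nhds l) := by
    refine hl.comp (tendsto_nhdsWithin_iff.2 ⟨?_, ?_⟩)
    · have : Filter.Tendsto (fun x : ℝ => c * x) (nhds 0) (nhds (c * 0)) :=
        (continuous_const_mul c).tendsto 0
      rw [mul_zero] at this
      exact tendsto_nhdsWithin_of_tendsto_nhds this
    · filter_upwards [self_mem_nhdsWithin] with x hx using mul_pos hc hx
  have hle : Φ 0 ≤ l := by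
    have hlim := le_of_tendsto_of_tendsto
      (((hl.const_mul 2⁻¹).add_const (2⁻¹ * Φ 0)).sub (hscale (c := 2⁻¹) (by norm_num)))
      (((((hscale (c := 2) (by norm_num)).const_mul 2⁻¹).add_const (2⁻¹ * Φ 0)).sub hl).const_mul
        2⁻¹)
      (by filter_upwards [self_mem_nhdsWithin] with x hx using h x (le_of_lt hx))
    linarith
  have hge : l ≤ Φ 0 := by
    have hlin : Filter.Tendsto (fun x : ℝ => (1 - x) * Φ 0 + x * Φ 1)
        (nhdsWithin 0 (Set.Ioi 0)) (nhds ((1 - 0) * Φ 0 + 0 * Φ 1)) :=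
      tendsto_nhdsWithin_of_tendsto_nhds (Continuous.tendsto (by fun_prop) 0)
    have hlim := le_of_tendsto_of_tendsto hl hlin (by
      filter_upwards [Ioo_mem_nhdsGT (zero_lt_one' ℝ)] with x hx
      have := hΦ.2 (x := 0) (y := 1) (by simp) (by simp) (sub_nonneg.2 hx.2.le) hx.1.le (by ring)
      simpa using this)
    linarith
  rw [← Set.Ioi_insert, continuousWithinAt_insert_self]
  rw [le_antisymm hge hle] at hl
  exact hl

/-- The strong law of large numbers for samples drawn from a product measure. -/
theorem ae_tendsto_average {Ω E : Type*} [MeasurableSpace Ω] (μ : Measure Ω)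
    [IsProbabilityMeasure μ] [NormedAddCommGroup E] [NormedSpace ℝ E] [CompleteSpace E]
    {φ : Ω → E} (hφ : Integrable φ μ) :
    ∀ᵐ s ∂(Measure.infinitePi fun _ : ℕ => μ),
      Filter.Tendsto (fun n : ℕ => (n : ℝ)⁻¹ • ∑ k ∈ Finset.range n, φ (s k)) Filter.atTop
        (nhds (∫ x, φ x ∂μ)) := by
  borelize E
  have hmp (k : ℕ) := measurePreserving_eval_infinitePi (fun _ : ℕ => μ) k
  set ψ := hφ.1.mk φ with hψ
  have hψm : StronglyMeasurable ψ := hφ.1.stronglyMeasurable_mk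
  have hae : φ =ᵐ[μ] ψ := hφ.1.ae_eq_mk
  have hψi : Integrable ψ μ := hφ.congr hae
  have hlaw := ProbabilityTheory.strong_law_ae (μ := Measure.infinitePi fun _ : ℕ => μ)
    (fun k s => ψ (s k)) ((hmp 0).integrable_comp_of_integrable hψi)
    (fun i j hij => (ProbabilityTheory.iIndepFun_infinitePi (P := fun _ : ℕ => μ)
      (X := fun _ => ψ) fun _ => hψm.measurable).indepFun hij)
    (fun k => by
      refine ⟨(hψm.measurable.comp (measurable_pi_apply k)).aemeasurable,
        (hψm.measurable.comp (measurable_pi_apply 0)).aemeasurable, ?_⟩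
      have hmap (k : ℕ) : Measure.map (fun s : ℕ → Ω => ψ (s k))
          (Measure.infinitePi fun _ : ℕ => μ) = Measure.map ψ μ := by
        rw [← (hmp k).map_eq, Measure.map_map hψm.measurable (hmp k).measurable]
        simp only [(hmp k).map_eq]
        rfl
      rw [hmap k, hmap 0])
  have hall : ∀ᵐ s ∂(Measure.infinitePi fun _ : ℕ => μ), ∀ k, φ (s k) = ψ (s k) :=
    ae_all_iff.2 fun k => (hmp k).quasiMeasurePreserving.ae hae
  have hint : ∫ s, ψ (s 0) ∂(Measure.infinitePi fun _ : ℕ => μ) = ∫ x, φ x ∂μ := by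
    rw [integral_congr_ae hae, ← (hmp 0).map_eq,
      integral_map (hmp 0).measurable.aemeasurable hψm.aestronglyMeasurable, (hmp 0).map_eq]
  filter_upwards [hlaw, hall] with s hs hsk
  rw [hint] at hs
  simpa only [hsk] using hs

/-- **Fatou's lemma** for Bochner integrals of nonnegative functions. -/
theorem integral_le_of_ae_tendsto {Ω : Type*} [MeasurableSpace Ω] {μ : Measure Ω}
    {g : ℕ → Ω → ℝ} {g' : Ω → ℝ} {L : ℕ → ℝ} {L' : ℝ}
    (hg : ∀ᶠ n in Filter.atTop, Integrable (g n) μ ∧ 0 ≤ᵐ[μ] g n ∧ ∫ ω, g n ω ∂μ ≤ L n)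
    (hg' : Integrable g' μ)
    (hlim : ∀ᵐ ω ∂μ, Filter.Tendsto (fun n => g n ω) Filter.atTop (nhds (g' ω)))
    (hL : Filter.Tendsto L Filter.atTop (nhds L')) : ∫ ω, g' ω ∂μ ≤ L' := by
  obtain ⟨N, hN⟩ := Filter.eventually_atTop.1 hg
  have hnn : 0 ≤ᵐ[μ] g' := by
    filter_upwards [hlim, ae_all_iff.2 fun n => (hN (n + N) (Nat.le_add_left _ _)).2.1]
      with ω h1 h2
    exact ge_of_tendsto' (h1.comp (Filter.tendsto_add_atTop_nat N)) h2
  have hL0 : 0 ≤ L' := ge_of_tendsto hL (by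
    filter_upwards [hg] with n hn using (integral_nonneg_of_ae hn.2.1).trans hn.2.2)
  rw [← ENNReal.ofReal_le_ofReal_iff hL0, ofReal_integral_eq_lintegral_ofReal hg' hnn]
  calc ∫⁻ ω, ENNReal.ofReal (g' ω) ∂μ
      = ∫⁻ ω, Filter.liminf (fun n => ENNReal.ofReal (g (n + N) ω)) Filter.atTop ∂μ := by
        refine lintegral_congr_ae ?_
        filter_upwards [hlim] with ω hω
        exact (((ENNReal.continuous_ofReal.tendsto _).comp
          (hω.comp (Filter.tendsto_add_atTop_nat N))).liminf_eq).symm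
    _ ≤ Filter.liminf (fun n => ∫⁻ ω, ENNReal.ofReal (g (n + N) ω) ∂μ) Filter.atTop :=
        lintegral_liminf_le' fun n =>
          (hN (n + N) (Nat.le_add_left _ _)).1.1.aemeasurable.ennreal_ofReal
    _ ≤ Filter.liminf (fun n => ENNReal.ofReal (L (n + N))) Filter.atTop := by
        refine Filter.liminf_le_liminf (.of_forall fun n => ?_)
        obtain ⟨h1, h2, h3⟩ := hN (n + N) (Nat.le_add_left _ _)
        rw [← ofReal_integral_eq_lintegral_ofReal h1 h2]
        exact ENNReal.ofReal_le_ofReal h3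
    _ = ENNReal.ofReal L' :=
        ((ENNReal.continuous_ofReal.tendsto _).comp
          (hL.comp (Filter.tendsto_add_atTop_nat N))).liminf_eq

section

variable {Ω : Type*} [MeasurableSpace Ω] {μ : Measure Ω} {d : ℕ}

theorem aestronglyMeasurable_mat {W : Ω → Mat d}
    (hW : ∀ i j, AEStronglyMeasurable (fun ω => W ω i j) μ) : AEStronglyMeasurable W μ := by
  have : AEMeasurable (fun ω => (fun i j => W ω i j : Fin d → Fin d → ℂ)) μ :=
    aemeasurable_pi_iff.2 fun i => aemeasurable_pi_iff.2 fun j => (hW i j).aemeasurable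
  exact this.aestronglyMeasurable

theorem continuous_ntr : Continuous (ntr : Mat d → ℝ) := by
  unfold ntr
  fun_prop

theorem aestronglyMeasurable_matFun {Φ : ℝ → ℝ} (hc : ContinuousOn Φ (Set.Ici 0)) {W : Ω → Mat d}
    (hW : ∀ i j, AEStronglyMeasurable (fun ω => W ω i j) μ) (hps : ∀ᵐ ω ∂μ, (W ω).PosSemidef) :
    AEStronglyMeasurable (fun ω => matFun Φ (W ω)) μ := by
  obtain ⟨G, hG, hGe⟩ := exists_continuous_eq_matFun d hc
  exact (hG.comp_aestronglyMeasurable (aestronglyMeasurable_mat hW)).congr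
    (hps.mono fun ω hω => hGe _ hω)

theorem MatIntegrable.integrable_ntr {W : Ω → Mat d} (hW : MatIntegrable μ W) :
    Integrable (fun ω => ntr (W ω)) μ := by
  simp only [ntr, Matrix.trace, Matrix.diag_apply, Complex.re_sum]
  exact (integrable_finsetSum _ fun i _ => (hW i i).re).div_const _

theorem ntr_expMat {W : Ω → Mat d} (hW : MatIntegrable μ W) :
    ntr (expMat μ W) = ∫ ω, ntr (W ω) ∂μ := by
  have hi (i : Fin d) : Integrable (fun ω => (W ω i i).re) μ := (hW i i).re
  simp only [ntr, Matrix.trace, Matrix.diag_apply, Complex.re_sum, expMat, Matrix.of_apply]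
  rw [integral_div, integral_finsetSum _ fun i _ => hi i]
  congr 1
  exact Finset.sum_congr rfl fun i _ => (integral_re (hW i i)).symm

theorem continuousOn_ntr_matFun {Φ : ℝ → ℝ} (hc : ContinuousOn Φ (Set.Ici 0)) :
    ContinuousOn (fun A : Mat d => ntr (matFun Φ A)) {A : Mat d | A.PosSemidef} := by
  obtain ⟨G, hG, hGe⟩ := exists_continuous_eq_matFun d hc
  exact (continuous_ntr.comp hG).continuousOn.congr fun A hA => by
    simp only [Function.comp_apply, hGe A hA]

theorem MatIntegrable.integrable {W : Ω → Mat d} (hW : MatIntegrable μ W) :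
    Integrable (fun ω i j => W ω i j) μ :=
  Integrable.of_eval fun i => Integrable.of_eval (hW i)

theorem expMat_eq_integral {W : Ω → Mat d} (hW : MatIntegrable μ W) :
    expMat μ W = Matrix.of (∫ ω, (fun i j => W ω i j) ∂μ) := by
  ext i j
  have h1 := eval_integral (μ := μ) (f := fun ω i j => W ω i j)
    (fun i => Integrable.of_eval (hW i)) i
  have h2 := eval_integral (μ := μ) (f := fun ω j => W ω i j) (hW i) j
  exact h2.symm.trans (congrFun h1.symm j)

theorem continuous_matrix_of : Continuous (Matrix.of : (Fin d → Fin d → ℂ) → Mat d) :=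
  continuous_id

variable [IsProbabilityMeasure μ]

theorem posSemidef_expMat {W : Ω → Mat d} (hW : MatIntegrable μ W)
    (hps : ∀ᵐ ω ∂μ, (W ω).PosSemidef) : (expMat μ W).PosSemidef := by
  rw [expMat_eq_integral hW]
  have hconv : Convex ℝ {A : Fin d → Fin d → ℂ | (Matrix.of A).PosSemidef} :=
    fun A hA B hB a b ha hb hab => convex_posSemidef d hA hB ha hb hab
  exact hconv.integral_mem ((isClosed_posSemidef d).preimage continuous_matrix_of) hps hW.integrable

/-- **Jensen's inequality** for the normalized trace of a convex matrix function. -/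
theorem ntr_matFun_expMat_le {Φ : ℝ → ℝ} (hΦ : ConvexOn ℝ (Set.Ici (0 : ℝ)) Φ)
    (hc : ContinuousOn Φ (Set.Ici 0)) {W : Ω → Mat d} (hW : MatIntegrable μ W)
    (hps : ∀ᵐ ω ∂μ, (W ω).PosSemidef) (hΦW : MatIntegrable μ fun ω => matFun Φ (W ω)) :
    ntr (matFun Φ (expMat μ W)) ≤ ∫ ω, ntr (matFun Φ (W ω)) ∂μ := by
  rw [expMat_eq_integral hW]
  have hconv : ConvexOn ℝ {A : Fin d → Fin d → ℂ | (Matrix.of A).PosSemidef}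
      fun A => ntr (matFun Φ (Matrix.of A)) :=
    ⟨fun A hA B hB a b ha hb hab => convex_posSemidef d hA hB ha hb hab,
      fun A hA B hB a b ha hb hab => (convexOn_ntr_matFun d hΦ).2 hA hB ha hb hab⟩
  exact hconv.map_integral_le
    ((continuousOn_ntr_matFun hc).comp continuous_matrix_of.continuousOn fun A hA => hA)
    ((isClosed_posSemidef d).preimage continuous_matrix_of) hps hW.integrable hΦW.integrable_ntr

theorem matIntegrable_matFun_of_le [NeZero d] {Φ : ℝ → ℝ} (hΦ : ConvexOn ℝ (Set.Ici (0 : ℝ)) Φ)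
    (hc : ContinuousOn Φ (Set.Ici 0)) {W : Ω → Mat d} (hW : MatIntegrable μ W)
    (hps : ∀ᵐ ω ∂μ, (W ω).PosSemidef) {u : Ω → ℝ} (hu : Integrable u μ)
    (hle : ∀ᵐ ω ∂μ, ntr (matFun Φ (W ω)) ≤ u ω) :
    MatIntegrable μ fun ω => matFun Φ (W ω) := by
  obtain ⟨a, b, hab⟩ := hΦ.exists_affine_le_real isClosed_Ici hc.lowerSemicontinuousOn
  have hm := aestronglyMeasurable_matFun hc (fun i j => (hW i j).1) hps
  intro i j
  refine Integrable.mono'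
    (((hu.add (hW.integrable_ntr.const_mul (2 * |a|))).add (integrable_const (2 * |b|))).const_mul
      (d : ℝ)) ?_ ?_
  · exact (show Continuous fun A : Mat d => A i j by fun_prop).comp_aestronglyMeasurable hm
  · filter_upwards [hps, hle] with ω h1 h2
    refine (norm_matFun_apply_le hab h1 i j).trans ?_
    simp only [Pi.add_apply]
    gcongr

end

/-- Random positive semidefinite matrices with finite `Φ`-entropy. -/
def entropyDomain {Ω : Type*} [MeasurableSpace Ω] (μ : Measure Ω) (d : ℕ) (Φ : ℝ → ℝ) :
    Set (Ω → Mat d) :=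
  {W | (∀ i j, Measurable fun ω => W ω i j) ∧ (∀ ω, (W ω).PosSemidef) ∧ MatIntegrable μ W ∧
    MatIntegrable μ fun ω => matFun Φ (W ω)}

/-- The matrix `Φ`-entropy of a random matrix. -/
def matEntropy {Ω : Type*} [MeasurableSpace Ω] (μ : Measure Ω) {d : ℕ} (Φ : ℝ → ℝ)
    (W : Ω → Mat d) : ℝ :=
  ntr (expMat μ (fun ω => matFun Φ (W ω)) - matFun Φ (expMat μ W))

theorem matEntropy_eq {Ω : Type*} [MeasurableSpace Ω] {μ : Measure Ω} {d : ℕ} {Φ : ℝ → ℝ}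
    {W : Ω → Mat d} (hW : MatIntegrable μ fun ω => matFun Φ (W ω)) :
    matEntropy μ Φ W = ∫ ω, ntr (matFun Φ (W ω)) ∂μ - ntr (matFun Φ (expMat μ W)) := by
  rw [matEntropy, ntr_sub, ntr_expMat hW]

theorem convex_entropyDomain {Ω : Type*} [MeasurableSpace Ω] (μ : Measure Ω)
    [IsProbabilityMeasure μ] (d : ℕ) [NeZero d] {Φ : ℝ → ℝ}
    (hΦ : ConvexOn ℝ (Set.Ici (0 : ℝ)) Φ) (hc : ContinuousOn Φ (Set.Ici 0)) :
    Convex ℝ (entropyDomain μ d Φ) := by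
  rintro X ⟨hXm, hX, hXi, hΦX⟩ Y ⟨hYm, hY, hYi, hΦY⟩ a b ha hb hab
  have hi : MatIntegrable μ (a • X + b • Y) := fun i j =>
    ((hXi i j).smul a).add ((hYi i j).smul b)
  have hps (ω) : ((a • X + b • Y) ω).PosSemidef := convex_posSemidef d (hX ω) (hY ω) ha hb hab
  refine ⟨fun i j => ((hXm i j).const_smul a).add ((hYm i j).const_smul b), hps, hi, ?_⟩
  exact matIntegrable_matFun_of_le hΦ hc hi (.of_forall hps)
    ((hΦX.integrable_ntr.const_mul a).add (hΦY.integrable_ntr.const_mul b))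
    (.of_forall fun ω => (convexOn_ntr_matFun d hΦ).2 (hX ω) (hY ω) ha hb hab)

theorem EntropyConvex.convexOn {d : ℕ} [NeZero d] {Φ : ℝ → ℝ} (h : EntropyConvex d Φ)
    (hΦ : ConvexOn ℝ (Set.Ici (0 : ℝ)) Φ) (hc : ContinuousOn Φ (Set.Ici 0)) {Ω : Type}
    [MeasurableSpace Ω] (μ : Measure Ω) [IsProbabilityMeasure μ] :
    ConvexOn ℝ (entropyDomain μ d Φ) (matEntropy μ Φ) := by
  refine ⟨convex_entropyDomain μ d hΦ hc, fun X hX Y hY a b ha hb hab => ?_⟩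
  obtain rfl : b = 1 - a := by linarith
  exact h Ω _ μ inferInstance X Y hX.1 hY.1 hX.2.1 hY.2.1 hX.2.2.1 hY.2.2.1 hX.2.2.2 hY.2.2.2 a
    ⟨ha, by linarith⟩ (convex_entropyDomain μ d hΦ hc hX hY ha hb hab).2.2.2

theorem MatIntegrable.ae_tendsto_average {Ω : Type*} [MeasurableSpace Ω] {μ : Measure Ω}
    [IsProbabilityMeasure μ] {d : ℕ} {W : Ω → Mat d} (hW : MatIntegrable μ W) :
    ∀ᵐ s ∂(Measure.infinitePi fun _ : ℕ => μ), ∀ i j,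
      Filter.Tendsto (fun n : ℕ => (n : ℝ)⁻¹ • ∑ k ∈ Finset.range n, W (s k) i j) Filter.atTop
        (nhds (expMat μ W i j)) :=
  ae_all_iff.2 fun i => ae_all_iff.2 fun j =>
    _root_.ae_tendsto_average μ (φ := fun ω => W ω i j) (hW i j)

section

variable {Ω₁ Ω₂ : Type*} [MeasurableSpace Ω₁] [MeasurableSpace Ω₂] {μ₁ : Measure Ω₁}
  {μ₂ : Measure Ω₂} [IsProbabilityMeasure μ₂] {d : ℕ} {Z : Ω₁ × Ω₂ → Mat d}

theorem MatIntegrable.expMat_section (hZ : MatIntegrable (μ₁.prod μ₂) Z) :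
    MatIntegrable μ₁ fun x₁ => expMat μ₂ fun x₂ => Z (x₁, x₂) :=
  fun i j => (hZ i j).integral_prod_left

variable [IsProbabilityMeasure μ₁]

theorem MatIntegrable.prod_swap (hZ : MatIntegrable (μ₁.prod μ₂) Z) :
    MatIntegrable (μ₂.prod μ₁) fun x => Z x.swap :=
  fun i j => (hZ i j).swap

theorem MatIntegrable.ae_section (hZ : MatIntegrable (μ₁.prod μ₂) Z) :
    ∀ᵐ x₁ ∂μ₁, MatIntegrable μ₂ fun x₂ => Z (x₁, x₂) :=
  ae_all_iff.2 fun i => ae_all_iff.2 fun j => (hZ i j).prod_right_ae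

theorem expMat_prod (hZ : MatIntegrable (μ₁.prod μ₂) Z) :
    expMat (μ₁.prod μ₂) Z = expMat μ₁ fun x₁ => expMat μ₂ fun x₂ => Z (x₁, x₂) := by
  ext i j
  exact integral_prod _ (hZ i j)

theorem expMat_prod_symm (hZ : MatIntegrable (μ₁.prod μ₂) Z) :
    expMat (μ₁.prod μ₂) Z = expMat μ₂ fun x₂ => expMat μ₁ fun x₁ => Z (x₁, x₂) := by
  ext i j
  exact integral_prod_symm _ (hZ i j)

theorem matIntegrable_matFun_expMat_section [NeZero d] {Φ : ℝ → ℝ}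
    (hΦ : ConvexOn ℝ (Set.Ici (0 : ℝ)) Φ) (hc : ContinuousOn Φ (Set.Ici 0))
    (hps : ∀ ω, (Z ω).PosSemidef) (hZ : MatIntegrable (μ₁.prod μ₂) Z)
    (hΦZ : MatIntegrable (μ₁.prod μ₂) fun ω => matFun Φ (Z ω)) :
    MatIntegrable μ₁ fun x₁ => matFun Φ (expMat μ₂ fun x₂ => Z (x₁, x₂)) := by
  refine matIntegrable_matFun_of_le hΦ hc hZ.expMat_section ?_
    hΦZ.integrable_ntr.integral_prod_left ?_
  · filter_upwards [hZ.ae_section] with x₁ h1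
    exact posSemidef_expMat h1 (.of_forall fun x₂ => hps _)
  · filter_upwards [hZ.ae_section, hΦZ.ae_section] with x₁ h1 h2
    exact ntr_matFun_expMat_le hΦ hc h1 (.of_forall fun x₂ => hps _) h2

/-- Almost every sample `s` of independent copies of the first coordinate satisfies the law of
large numbers for almost every value of the second coordinate. -/
theorem ae_ae_tendsto_average (hm : ∀ i j, Measurable fun ω => Z ω i j)
    (hZ : MatIntegrable (μ₁.prod μ₂) Z) :
    ∀ᵐ s ∂(Measure.infinitePi fun _ : ℕ => μ₁), ∀ᵐ x₂ ∂μ₂, ∀ i j,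
      Filter.Tendsto (fun n : ℕ => (n : ℝ)⁻¹ • ∑ k ∈ Finset.range n, Z (s k, x₂) i j) Filter.atTop
        (nhds (expMat μ₁ (fun x₁ => Z (x₁, x₂)) i j)) := by
  refine Measure.ae_ae_comm (μ := Measure.infinitePi fun _ : ℕ => μ₁) (ν := μ₂)
    (p := fun s x₂ => ∀ i j, Filter.Tendsto
      (fun n : ℕ => (n : ℝ)⁻¹ • ∑ k ∈ Finset.range n, Z (s k, x₂) i j) Filter.atTop
        (nhds (expMat μ₁ (fun x₁ => Z (x₁, x₂)) i j))) ?_ |>.2 ?_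
  · simp only [Set.ofPred_forall]
    refine MeasurableSet.iInter fun i => MeasurableSet.iInter fun j => ?_
    refine measurableSet_tendsto_fun (fun n => ?_) ?_
    · have hsum : Measurable fun x : (ℕ → Ω₁) × Ω₂ => ∑ k ∈ Finset.range n, Z (x.1 k, x.2) i j :=
        Finset.measurable_sum _ fun k _ => (hm i j).comp
          (((measurable_pi_apply k).comp measurable_fst).prodMk measurable_snd)
      exact hsum.const_smul (n : ℝ)⁻¹
    · have : StronglyMeasurable fun x₂ : Ω₂ => ∫ x₁, Z (x₁, x₂) i j ∂μ₁ :=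
        (hm i j).stronglyMeasurable.integral_prod_left'
      exact this.measurable.comp measurable_snd
  · filter_upwards [hZ.prod_swap.ae_section] with x₂ h
    exact h.ae_tendsto_average

end

theorem tendsto_mat {ι : Type*} {l : Filter ι} {d : ℕ} {F : ι → Mat d} {A : Mat d}
    (h : ∀ i j, Filter.Tendsto (fun n => F n i j) l (nhds (A i j))) :
    Filter.Tendsto F l (nhds A) :=
  tendsto_pi_nhds.2 fun i => tendsto_pi_nhds.2 fun j => h i j

/-- The average of the first `n` terms of a sequence of random matrices. -/
def averageMat {Ω : Type*} {d : ℕ} (V : ℕ → Ω → Mat d) (n : ℕ) : Ω → Mat d :=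
  ∑ k ∈ Finset.range n, (n : ℝ)⁻¹ • V k

theorem averageMat_apply {Ω : Type*} {d : ℕ} (V : ℕ → Ω → Mat d) (n : ℕ) (ω : Ω) (i j : Fin d) :
    averageMat V n ω i j = (n : ℝ)⁻¹ • ∑ k ∈ Finset.range n, V k ω i j := by
  simp only [averageMat, Finset.sum_apply, Pi.smul_apply, Matrix.sum_apply, Matrix.smul_apply,
    Finset.smul_sum]

theorem expMat_averageMat_apply {Ω : Type*} [MeasurableSpace Ω] {μ : Measure Ω} {d : ℕ}
    {V : ℕ → Ω → Mat d} (hV : ∀ k, MatIntegrable μ (V k)) (n : ℕ) (i j : Fin d) :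
    expMat μ (averageMat V n) i j = (n : ℝ)⁻¹ • ∑ k ∈ Finset.range n, expMat μ (V k) i j := by
  simp only [expMat, Matrix.of_apply, averageMat_apply]
  rw [integral_smul, integral_finsetSum _ fun k _ => hV k i j]

theorem sum_range_inv {n : ℕ} (hn : 0 < n) : ∑ _k ∈ Finset.range n, (n : ℝ)⁻¹ = 1 := by
  have : (n : ℝ) ≠ 0 := by positivity
  simp [this]

theorem Convex.averageMat_mem {Ω : Type*} {d : ℕ} {S : Set (Ω → Mat d)} (hS : Convex ℝ S)
    {V : ℕ → Ω → Mat d} (hV : ∀ k, V k ∈ S) {n : ℕ} (hn : 0 < n) : averageMat V n ∈ S :=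
  hS.sum_mem (fun _ _ => by positivity) (sum_range_inv hn) fun k _ => hV k

theorem ConvexOn.map_averageMat_le {Ω : Type*} {d : ℕ} {S : Set (Ω → Mat d)}
    {H : (Ω → Mat d) → ℝ} (hH : ConvexOn ℝ S H) {V : ℕ → Ω → Mat d} (hV : ∀ k, V k ∈ S) {n : ℕ}
    (hn : 0 < n) : H (averageMat V n) ≤ (n : ℝ)⁻¹ • ∑ k ∈ Finset.range n, H (V k) := by
  rw [Finset.smul_sum]
  exact hH.map_sum_le (fun _ _ => by positivity) (sum_range_inv hn) fun k _ => hV k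

theorem integrable_ntr_matFun_sub_affine {Ω : Type*} [MeasurableSpace Ω] {μ : Measure Ω}
    [IsProbabilityMeasure μ] {d : ℕ} {Φ : ℝ → ℝ} (a b : ℝ) {V : Ω → Mat d}
    (hV : MatIntegrable μ V) (hΦV : MatIntegrable μ fun ω => matFun Φ (V ω)) :
    Integrable (fun ω => ntr (matFun Φ (V ω)) - a * ntr (V ω) - b) μ :=
  (hΦV.integrable_ntr.sub (hV.integrable_ntr.const_mul a)).sub (integrable_const b)

theorem integral_ntr_matFun_sub_affine {Ω : Type*} [MeasurableSpace Ω] {μ : Measure Ω}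
    [IsProbabilityMeasure μ] {d : ℕ} {Φ : ℝ → ℝ} (a b : ℝ) {V : Ω → Mat d}
    (hV : MatIntegrable μ V) (hΦV : MatIntegrable μ fun ω => matFun Φ (V ω)) :
    ∫ ω, ntr (matFun Φ (V ω)) - a * ntr (V ω) - b ∂μ =
      matEntropy μ Φ V + (ntr (matFun Φ (expMat μ V)) - a * ntr (expMat μ V) - b) := by
  have h1 := hΦV.integrable_ntr
  have h2 := hV.integrable_ntr.const_mul a
  have h3 : Integrable (fun ω => ntr (matFun Φ (V ω)) - a * ntr (V ω)) μ := h1.sub h2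
  rw [integral_sub h3 (integrable_const b), integral_sub h1 h2, integral_const_mul,
    matEntropy_eq hΦV, ntr_expMat hV, integral_const, probReal_univ, one_smul]
  ring

/-- Almost every sequence of independent copies of the first coordinate satisfies the laws of large
numbers for the conditional entropies, the conditional means and the sections of `Z`. -/
theorem exists_sample {Ω₁ Ω₂ : Type*} [MeasurableSpace Ω₁] [MeasurableSpace Ω₂] {μ₁ : Measure Ω₁}
    {μ₂ : Measure Ω₂} [IsProbabilityMeasure μ₁] [IsProbabilityMeasure μ₂] {d : ℕ} [NeZero d]
    {Φ : ℝ → ℝ} (hΦ : ConvexOn ℝ (Set.Ici (0 : ℝ)) Φ) (hc : ContinuousOn Φ (Set.Ici 0))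
    {Z : Ω₁ × Ω₂ → Mat d} (hm : ∀ i j, Measurable fun ω => Z ω i j) (hps : ∀ ω, (Z ω).PosSemidef)
    (hZ : MatIntegrable (μ₁.prod μ₂) Z)
    (hΦZ : MatIntegrable (μ₁.prod μ₂) fun ω => matFun Φ (Z ω)) :
    ∃ s : ℕ → Ω₁, (∀ k, (fun x₂ => Z (s k, x₂)) ∈ entropyDomain μ₂ d Φ) ∧
      Filter.Tendsto (fun n : ℕ => (n : ℝ)⁻¹ • ∑ k ∈ Finset.range n,
        matEntropy μ₂ Φ fun x₂ => Z (s k, x₂)) Filter.atTop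
        (nhds (∫ x₁, matEntropy μ₂ Φ (fun x₂ => Z (x₁, x₂)) ∂μ₁)) ∧
      (∀ i j, Filter.Tendsto (fun n : ℕ => (n : ℝ)⁻¹ • ∑ k ∈ Finset.range n,
        expMat μ₂ (fun x₂ => Z (s k, x₂)) i j) Filter.atTop
        (nhds (expMat (μ₁.prod μ₂) Z i j))) ∧
      ∀ᵐ x₂ ∂μ₂, ∀ i j, Filter.Tendsto
        (fun n : ℕ => (n : ℝ)⁻¹ • ∑ k ∈ Finset.range n, Z (s k, x₂) i j) Filter.atTop
        (nhds (expMat μ₁ (fun x₁ => Z (x₁, x₂)) i j)) := by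
  have hdom : ∀ᵐ x₁ ∂μ₁, (fun x₂ => Z (x₁, x₂)) ∈ entropyDomain μ₂ d Φ := by
    filter_upwards [hZ.ae_section, hΦZ.ae_section] with x₁ h1 h2
    exact ⟨fun i j => (hm i j).comp measurable_prodMk_left, fun x₂ => hps _, h1, h2⟩
  have hent : Integrable (fun x₁ => matEntropy μ₂ Φ fun x₂ => Z (x₁, x₂)) μ₁ := by
    refine Integrable.congr (hΦZ.integrable_ntr.integral_prod_left.sub
      (matIntegrable_matFun_expMat_section hΦ hc hps hZ hΦZ).integrable_ntr) ?_
    filter_upwards [hdom] with x₁ h1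
    exact (matEntropy_eq h1.2.2.2).symm
  have h1 : ∀ᵐ s ∂(Measure.infinitePi fun _ : ℕ => μ₁),
      ∀ k, (fun x₂ => Z (s k, x₂)) ∈ entropyDomain μ₂ d Φ :=
    ae_all_iff.2 fun k =>
      (measurePreserving_eval_infinitePi (fun _ : ℕ => μ₁) k).quasiMeasurePreserving.ae hdom
  have h2 : ∀ᵐ s ∂(Measure.infinitePi fun _ : ℕ => μ₁), ∀ i j,
      Filter.Tendsto (fun n : ℕ => (n : ℝ)⁻¹ • ∑ k ∈ Finset.range n,
        expMat μ₂ (fun x₂ => Z (s k, x₂)) i j) Filter.atTop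
        (nhds (expMat (μ₁.prod μ₂) Z i j)) := by
    rw [expMat_prod hZ]
    exact hZ.expMat_section.ae_tendsto_average
  have h3 := ae_tendsto_average μ₁ hent
  have h4 := ae_ae_tendsto_average hm hZ
  exact (h1.and (h3.and (h2.and h4))).exists

theorem EntropyConvex.conditionalJensen {d : ℕ} [NeZero d] {Φ : ℝ → ℝ} (h : EntropyConvex d Φ)
    (hΦ : ConvexOn ℝ (Set.Ici (0 : ℝ)) Φ) : ConditionalJensen d Φ := by
  have hc : ContinuousOn Φ (Set.Ici 0) :=
    hΦ.continuousOn_Ici_of_scalar_twoPoint fun x hx => h.scalar_twoPoint hx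
  obtain ⟨a, b, hab⟩ := hΦ.exists_affine_le_real isClosed_Ici hc.lowerSemicontinuousOn
  intro Ω₁ Ω₂ _ _ μ₁ μ₂ _ _ Z hm hps hZ hΦZ
  obtain ⟨s, hs_dom, hs_ent, hs_mean, hs_sec⟩ := exists_sample hΦ hc hm hps hZ hΦZ
  set W : ℕ → Ω₂ → Mat d := averageMat fun k x₂ => Z (s k, x₂) with hW
  have hconvex := h.convexOn hΦ hc μ₂
  have hW_dom {n : ℕ} (hn : 0 < n) : W n ∈ entropyDomain μ₂ d Φ :=
    hconvex.1.averageMat_mem hs_dom hn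
  have hE_lim : Filter.Tendsto (fun n => expMat μ₂ (W n)) Filter.atTop
      (nhds (expMat (μ₁.prod μ₂) Z)) :=
    tendsto_mat fun i j => by
      simpa only [hW, expMat_averageMat_apply fun k => (hs_dom k).2.2.1] using hs_mean i j
  have hW_lim : ∀ᵐ x₂ ∂μ₂, Filter.Tendsto (fun n => W n x₂) Filter.atTop
      (nhds (expMat μ₁ fun x₁ => Z (x₁, x₂))) := by
    filter_upwards [hs_sec] with x₂ hx
    exact tendsto_mat fun i j => by simpa only [hW, averageMat_apply] using hx i j
  obtain ⟨G, hG, hGe⟩ := exists_continuous_eq_matFun d hc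
  have hcont : Continuous fun A : Mat d => ntr (G A) - a * ntr A - b :=
    ((continuous_ntr.comp hG).sub (continuous_ntr.const_mul a)).sub continuous_const
  have hE1 : MatIntegrable μ₂ fun x₂ => expMat μ₁ fun x₁ => Z (x₁, x₂) :=
    hZ.prod_swap.expMat_section (Z := fun x => Z x.swap)
  have hΦE1 : MatIntegrable μ₂ fun x₂ => matFun Φ (expMat μ₁ fun x₁ => Z (x₁, x₂)) :=
    matIntegrable_matFun_expMat_section (Z := fun x => Z x.swap) hΦ hc (fun ω => hps _)
      hZ.prod_swap hΦZ.prod_swap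
  have hsec : ∀ᵐ x₂ ∂μ₂, MatIntegrable μ₁ fun x₁ => Z (x₁, x₂) :=
    hZ.prod_swap.ae_section (Z := fun x => Z x.swap)
  have hE1_ps : ∀ᵐ x₂ ∂μ₂, (expMat μ₁ fun x₁ => Z (x₁, x₂)).PosSemidef := by
    filter_upwards [hsec] with x₂ hx
    exact posSemidef_expMat hx (.of_forall fun x₁ => hps _)
  have hEE : (expMat (μ₁.prod μ₂) Z).PosSemidef := posSemidef_expMat hZ (.of_forall hps)
  have hg (n : ℕ) (hn : 0 < n) :
      Integrable (fun x₂ => ntr (matFun Φ (W n x₂)) - a * ntr (W n x₂) - b) μ₂ ∧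
      0 ≤ᵐ[μ₂] (fun x₂ => ntr (matFun Φ (W n x₂)) - a * ntr (W n x₂) - b) ∧
      ∫ x₂, ntr (matFun Φ (W n x₂)) - a * ntr (W n x₂) - b ∂μ₂ ≤
        (n : ℝ)⁻¹ • ∑ k ∈ Finset.range n, (matEntropy μ₂ Φ fun x₂ => Z (s k, x₂))
          + (ntr (G (expMat μ₂ (W n))) - a * ntr (expMat μ₂ (W n)) - b) := by
    obtain ⟨-, h2, h3, h4⟩ := hW_dom hn
    have hnn (x₂ : Ω₂) : 0 ≤ ntr (matFun Φ (W n x₂)) - a * ntr (W n x₂) - b := by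
      linarith [exists_affine_le_ntr_matFun d hab (h2 x₂)]
    refine ⟨integrable_ntr_matFun_sub_affine a b h3 h4, Filter.Eventually.of_forall hnn, ?_⟩
    rw [integral_ntr_matFun_sub_affine a b h3 h4, hGe _ (posSemidef_expMat h3 (.of_forall h2))]
    gcongr
    exact hconvex.map_averageMat_le hs_dom hn
  have hlim : ∀ᵐ x₂ ∂μ₂, Filter.Tendsto
      (fun n => ntr (matFun Φ (W n x₂)) - a * ntr (W n x₂) - b) Filter.atTop
      (nhds (ntr (matFun Φ (expMat μ₁ fun x₁ => Z (x₁, x₂)))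
        - a * ntr (expMat μ₁ fun x₁ => Z (x₁, x₂)) - b)) := by
    filter_upwards [hW_lim, hE1_ps] with x₂ h1 h2
    have h3 : Filter.Tendsto (fun n => ntr (G (W n x₂)) - a * ntr (W n x₂) - b) Filter.atTop
        (nhds (ntr (G (expMat μ₁ fun x₁ => Z (x₁, x₂)))
          - a * ntr (expMat μ₁ fun x₁ => Z (x₁, x₂)) - b)) := (hcont.tendsto _).comp h1
    rw [hGe _ h2] at h3
    refine h3.congr' ?_
    filter_upwards [Filter.eventually_gt_atTop 0] with n hn
    simp only [hGe _ ((hW_dom hn).2.1 x₂)]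
  have hL := hs_ent.add ((hcont.tendsto _).comp hE_lim)
  have key := integral_le_of_ae_tendsto
    (Filter.eventually_atTop.2 ⟨1, fun n hn => hg n hn⟩)
    (integrable_ntr_matFun_sub_affine a b hE1 hΦE1) hlim hL
  rw [integral_ntr_matFun_sub_affine a b hE1 hΦE1, ← expMat_prod_symm hZ, hGe _ hEE] at key
  have := le_of_add_le_add_right key
  rwa [matEntropy, ← expMat_prod_symm hZ] at this

/-- **Equivalence of convexity of the matrix `Φ`-entropy functional (h) and the conditional
Jensen inequality (g)** (part of Theorem 3.4). -/
theorem entropy_convex_iff_conditional_jensen (d : ℕ) (Φ : ℝ → ℝ)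
    (hconv : ConvexOn ℝ (Set.Ici (0 : ℝ)) Φ) :
    EntropyConvex d Φ ↔ ConditionalJensen d Φ := by
  refine ⟨fun h => ?_, fun h => h.entropyConvex⟩
  rcases Nat.eq_zero_or_pos d with rfl | hd
  · intro Ω₁ Ω₂ _ _ μ₁ μ₂ _ _ Z _ _ _ _
    simp [ntr]
  · have : NeZero d := ⟨hd.ne'⟩
    exact h.conditionalJensen hconv
end
end
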